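/- arXiv:1411.4795 — 6 statements merged into one kernel-verified Lean document; each statement's English description precedes it below -/
import Mathlib

section
/- Every weak-local derivation on a C*-algebra is continuous. That is, if A is a C*-algebra and T : A → A is a linear map such that for every a ∈ A and every state φ on A there exists a derivation D (depending on a and φ) with φ(T(a)) = φ(D(a)), then T is bounded. -/
open scoped ComplexOrder

variable {A : Type*} [NormedRing A] [StarRing A] [CStarRing A] [CompleteSpace A]
  [NormedAlgebra ℂ A] [StarModule ℂ A]

/-- A state on a C*-algebra: a norm-one positive continuous linear functional. -/
def IsState (φ : A →L[ℂ] ℂ) : Prop :=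
  ‖φ‖ = 1 ∧ ∀ a : A, 0 ≤ φ (star a * a)

/-- A derivation on a C*-algebra: a linear map satisfying the Leibniz rule. -/
def IsDerivation (D : A → A) : Prop :=
  IsLinearMap ℂ D ∧ ∀ a b : A, D (a * b) = D a * b + a * D b

/-- A weak-local derivation: a linear map that agrees with some derivation at each point,
up to each state. -/
def IsWeakLocalDerivation (T : A → A) : Prop :=
  IsLinearMap ℂ T ∧ ∀ (a : A) (φ : A →L[ℂ] ℂ), IsState φ →
    ∃ D : A → A, IsDerivation D ∧ φ (T a) = φ (D a)

section CStarAux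

open Filter Topology

variable {B : Type*} [CStarAlgebra B]

theorem wld_exists_sqrt (x : B) (hx : IsSelfAdjoint x) :
    ∃ b : B, IsSelfAdjoint b ∧ b * b = (‖x‖ : ℂ) • (1 : B) - x := by
  let _ := CStarAlgebra.spectralOrder B
  have _ := CStarAlgebra.spectralOrderedRing B
  have h : 0 ≤ (‖x‖ : ℂ) • (1 : B) - x := by
    have := IsSelfAdjoint.le_algebraMap_norm_self hx
    rw [Algebra.algebraMap_eq_smul_one] at this
    rw [sub_nonneg]
    convert this using 1
    simp
  exact ⟨CFC.sqrt _, (CFC.sqrt_nonneg _).isSelfAdjoint, CFC.sqrt_mul_sqrt_self _ h⟩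

theorem wld_norm_sub (a : B) :
    ‖(‖star a * a‖ : ℂ) • (1 : B) - star a * a‖ ≤ ‖star a * a‖ := by
  let _ := CStarAlgebra.spectralOrder B
  have _ := CStarAlgebra.spectralOrderedRing B
  have e : (‖star a * a‖ : ℂ) • (1 : B) = algebraMap ℝ B ‖star a * a‖ := by
    rw [Algebra.algebraMap_eq_smul_one]; simp
  rw [e]
  have h : 0 ≤ algebraMap ℝ B ‖star a * a‖ - star a * a :=
    sub_nonneg.2 (IsSelfAdjoint.le_algebraMap_norm_self (IsSelfAdjoint.star_mul_self a))
  rw [CStarAlgebra.norm_le_iff_le_algebraMap _ (norm_nonneg _) h]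
  exact sub_le_self _ (star_mul_self_nonneg a)

theorem wld_norm_one_add [Nontrivial B] (x : B) (hx : ‖x‖ ∈ spectrum ℝ x) :
    ‖1 + x‖ = 1 + ‖x‖ := by
  apply le_antisymm
  · exact (norm_add_le _ _).trans (by simp)
  · have h : (1 + ‖x‖) ∈ spectrum ℝ (1 + x) := by
      have := (spectrum.add_mem_add_iff (R := ℝ) (a := x) (r := ‖x‖) (s := 1)).2 hx
      simpa [add_comm] using this
    have := spectrum.norm_le_norm_of_mem h
    rwa [Real.norm_of_nonneg (by positivity)] at this

theorem wld_norm_alt [Nontrivial B] (x : B) (hx : IsSelfAdjoint x) :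
    ‖1 + x‖ = 1 + ‖x‖ ∨ ‖1 + -x‖ = 1 + ‖-x‖ := by
  let _ := CStarAlgebra.spectralOrder B
  have _ := CStarAlgebra.spectralOrderedRing B
  rcases CStarAlgebra.norm_or_neg_norm_mem_spectrum hx with h | h
  · exact Or.inl (wld_norm_one_add x h)
  · refine Or.inr (wld_norm_one_add _ ?_)
    rw [norm_neg, ← spectrum.neg_eq]
    simpa using h

theorem wld_real_of_bound (α β c : ℝ) (h : ∀ t : ℝ, α ^ 2 + (β + t) ^ 2 ≤ c + t ^ 2) : β = 0 := by
  by_contra hb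
  have := h ((c + 1) / (2 * β))
  have e : 2 * β * ((c + 1) / (2 * β)) = c + 1 := by field_simp
  nlinarith [sq_nonneg α, sq_nonneg β]

theorem wld_im_zero [Nontrivial B] (φ : B →L[ℂ] ℂ) (h1 : ‖φ‖ = 1) (h2 : φ 1 = 1) (x : B)
    (hx : IsSelfAdjoint x) : (φ x).im = 0 := by
  refine wld_real_of_bound (φ x).re _ (‖x‖ ^ 2) fun t => ?_
  have e : φ (x + ((t : ℂ) * Complex.I) • (1 : B)) = φ x + t * Complex.I := by
    simp [h2]
  have l := φ.le_opNorm (x + ((t : ℂ) * Complex.I) • (1 : B))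
  rw [e, h1, one_mul] at l
  have l2 : ‖x + ((t : ℂ) * Complex.I) • (1 : B)‖ ^ 2 ≤ ‖x‖ ^ 2 + t ^ 2 := by
    rw [sq, ← CStarRing.norm_star_mul_self]
    have : star (x + ((t : ℂ) * Complex.I) • (1 : B)) * (x + ((t : ℂ) * Complex.I) • (1 : B))
        = x * x + ((t : ℂ) ^ 2) • (1 : B) := by
      simp only [star_add, star_smul, star_one, hx.star_eq, add_mul, mul_add, smul_mul_assoc,
        mul_smul_comm, one_mul, mul_one, star_mul']
      simp only [Complex.star_def, Complex.conj_I, Complex.conj_ofReal]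
      have : (t : ℂ) ^ 2 = (t * -Complex.I) * (t * Complex.I) := by
        ring_nf; simp
      rw [this]
      module
    rw [this]
    refine (norm_add_le _ _).trans (add_le_add ?_ ?_)
    · exact (norm_mul_le _ _).trans (sq _).ge
    · simp [norm_smul]
  have l3 : ‖φ x + t * Complex.I‖ ^ 2 = (φ x).re ^ 2 + ((φ x).im + t) ^ 2 := by
    rw [← Complex.normSq_eq_norm_sq, Complex.normSq_apply]; simp; ring
  rw [← l3]
  exact (pow_le_pow_left₀ (norm_nonneg _) l 2).trans l2

theorem wld_star [Nontrivial B] (φ : B →L[ℂ] ℂ) (h1 : ‖φ‖ = 1) (h2 : φ 1 = 1) (x : B) :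
    φ (star x) = star (φ x) := by
  have a := wld_im_zero φ h1 h2 (x + star x) (IsSelfAdjoint.add_star_self x)
  have b := wld_im_zero φ h1 h2 (Complex.I • (x - star x)) (by
    rw [IsSelfAdjoint]; simp [star_smul]
    module)
  simp at a b
  apply Complex.ext <;> simp <;> linarith

theorem wld_pos [Nontrivial B] (φ : B →L[ℂ] ℂ) (h1 : ‖φ‖ = 1) (h2 : φ 1 = 1) (a : B) :
    0 ≤ φ (star a * a) := by
  rw [Complex.nonneg_iff]
  refine ⟨?_, (wld_im_zero φ h1 h2 _ (IsSelfAdjoint.star_mul_self a)).symm⟩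
  have l := (φ.le_opNorm _).trans (mul_le_mul_of_nonneg_left (wld_norm_sub a) (norm_nonneg φ))
  rw [h1, one_mul] at l
  have := (Complex.re_le_norm _).trans l
  simp only [map_sub, map_smul, h2, Complex.sub_re, smul_eq_mul, mul_one, Complex.ofReal_re] at this
  linarith

theorem wld_cs [Nontrivial B] (φ : B →L[ℂ] ℂ) (h1 : ‖φ‖ = 1) (h2 : φ 1 = 1) (b y : B)
    (hb : IsSelfAdjoint b) (h0 : φ (b * b) = 0) : φ (y * b) = 0 := by
  have key : ∀ s : ℂ, 0 ≤ (φ (y * star y)).re + 2 * (s * φ (y * b)).re := by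
    intro s
    have p := (Complex.nonneg_iff.1 (wld_pos φ h1 h2 (star y + s • b))).1
    have e : φ (b * star y) = star (φ (y * b)) := by
      rw [← wld_star φ h1 h2]; simp [hb.star_eq]
    simp only [star_add, star_star, star_smul, hb.star_eq, add_mul, mul_add, smul_mul_assoc,
      mul_smul_comm, map_add, map_smul, h0, e] at p
    simp at p ⊢
    linarith
  by_contra hne
  have hn : 0 < Complex.normSq (φ (y * b)) := Complex.normSq_pos.2 hne
  have := key (-(((φ (y * star y)).re + 1) / Complex.normSq (φ (y * b)) : ℝ)
    * star (φ (y * b)))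
  rw [mul_assoc, Complex.star_def, ← Complex.normSq_eq_conj_mul_self] at this
  rw [← Complex.ofReal_neg, ← Complex.ofReal_mul, Complex.ofReal_re, neg_mul,
    div_mul_cancel₀ _ hn.ne'] at this
  have p := (Complex.nonneg_iff.1 (wld_pos φ h1 h2 (star y))).1
  rw [star_star] at p
  linarith

theorem wld_state_aux [Nontrivial B] (x : B) (hx : IsSelfAdjoint x) (h : ‖1 + x‖ = 1 + ‖x‖) :
    ∃ φ : B →L[ℂ] ℂ, IsState φ ∧ ‖φ x‖ = ‖x‖ ∧ (∀ a, φ (star a) = star (φ a)) ∧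
      ∀ D : B → B, IsDerivation D → φ (D x) = 0 := by
  obtain ⟨φ, h1, hφ⟩ := exists_dual_vector' ℂ (1 + x)
  have n1 : ‖φ 1‖ ≤ 1 := by simpa [h1] using φ.le_opNorm 1
  have nx : ‖φ x‖ ≤ ‖x‖ := by simpa [h1] using φ.le_opNorm x
  rw [h, map_add] at hφ
  have hre := congrArg Complex.re hφ
  simp at hre
  have r1 := Complex.re_le_norm (φ 1)
  have rx := Complex.re_le_norm (φ x)
  have h2 : φ 1 = 1 := by
    have a : (φ 1).re = 1 := by linarith
    have b := Complex.normSq_eq_norm_sq (φ 1)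
    rw [Complex.normSq_apply, a] at b
    have : (φ 1).im = 0 := by nlinarith [norm_nonneg (φ 1)]
    exact Complex.ext a this
  have h3 : φ x = ‖x‖ := by
    rw [h2] at hφ
    push_cast at hφ
    exact add_left_cancel hφ
  refine ⟨φ, ⟨h1, wld_pos φ h1 h2⟩, by simp [h3], wld_star φ h1 h2, fun D hD => ?_⟩
  obtain ⟨b, hb, hbb⟩ := wld_exists_sqrt x hx
  have h0 : φ (b * b) = 0 := by rw [hbb]; simp [h2, h3]
  have D1 : D 1 = 0 := by
    have := hD.2 1 1
    simpa using this
  have ex : x = (‖x‖ : ℂ) • (1 : B) - b * b := by rw [hbb]; abel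
  have Dx : D x = -(D b * b + b * D b) := by
    conv_lhs => rw [ex]
    rw [hD.1.map_sub, hD.1.map_smul, D1, hD.2]; simp
  have c1 := wld_cs φ h1 h2 b (D b) hb h0
  have c2 : φ (b * D b) = 0 := by
    have := wld_cs φ h1 h2 b (star (D b)) hb h0
    have e := wld_star φ h1 h2 (star (D b) * b)
    rw [this] at e
    simpa [hb.star_eq] using e
  rw [Dx]; simp [c1, c2]

theorem wld_state [Nontrivial B] (x : B) (hx : IsSelfAdjoint x) :
    ∃ φ : B →L[ℂ] ℂ, IsState φ ∧ ‖φ x‖ = ‖x‖ ∧ (∀ a, φ (star a) = star (φ a)) ∧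
      ∀ D : B → B, IsDerivation D → φ (D x) = 0 := by
  rcases wld_norm_alt x hx with h | h
  · exact wld_state_aux x hx h
  · obtain ⟨φ, h1, h2, h3, h4⟩ := wld_state_aux (-x) hx.neg h
    refine ⟨φ, h1, by simpa using h2, h3, fun D hD => ?_⟩
    have := h4 D hD
    rw [hD.1.map_neg] at this
    simpa using this

theorem wld_closable (S : B →ₗ[ℂ] B)
    (hd : ∀ x, IsSelfAdjoint x → ∀ μ : ℝ, ‖x‖ ≤ ‖x + (μ : ℂ) • S x‖)
    (u : ℕ → B) (hu : ∀ n, IsSelfAdjoint (u n)) (y : B) (hy : IsSelfAdjoint y)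
    (h0 : Tendsto u atTop (𝓝 0)) (h1 : Tendsto (fun n => S (u n)) atTop (𝓝 y)) : y = 0 := by
  have A1 : ∀ t : ℝ, 0 < t → ‖y‖ ≤ ‖(t : ℂ) • S y‖ := by
    intro t ht
    have B1 : ∀ n, ‖u n + (t : ℂ) • (-y)‖
        ≤ ‖(u n + (t : ℂ) • (-y)) + (t : ℂ) • (S (u n) + (t : ℂ) • (-S y))‖ := by
      intro n
      have hs : IsSelfAdjoint ((t : ℂ) • (-y)) :=
        IsSelfAdjoint.smul (by simp [IsSelfAdjoint]) hy.neg
      have := hd _ ((hu n).add hs) t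
      simpa only [map_add, map_smul, map_neg] using this
    have L := (h0.add_const ((t : ℂ) • (-y))).norm
    have R := ((h0.add_const ((t : ℂ) • (-y))).add
      ((h1.add_const ((t : ℂ) • (-S y))).const_smul (t : ℂ))).norm
    have C := le_of_tendsto_of_tendsto' L R B1
    have e : (0 : B) + (t : ℂ) • (-y) + (t : ℂ) • (y + (t : ℂ) • (-S y))
        = (t : ℂ) • (-((t : ℂ) • S y)) := by module
    rw [e, zero_add, norm_smul, norm_smul, norm_neg, norm_neg] at C
    exact le_of_mul_le_mul_left C (by simpa using ht.ne')
  have T1 : Tendsto (fun t : ℝ => ‖(t : ℂ) • S y‖) (𝓝[>] 0) (𝓝 0) := by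
    have : Continuous (fun t : ℝ => ‖(t : ℂ) • S y‖) := by fun_prop
    simpa using (this.tendsto 0).mono_left nhdsWithin_le_nhds
  have := ge_of_tendsto T1 (b := ‖y‖) (by
    filter_upwards [self_mem_nhdsWithin] with t ht using A1 t ht)
  exact norm_le_zero_iff.1 this

theorem wld_cont_star (S : B →ₗ[ℂ] B) (hs : ∀ a, S (star a) = star (S a))
    (hd : ∀ x, IsSelfAdjoint x → ∀ μ : ℝ, ‖x‖ ≤ ‖x + (μ : ℂ) • S x‖) : Continuous S := by
  refine S.continuous_of_seq_closed_graph fun u x y hu hSu => ?_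
  have key : ∀ (v : ℕ → B) (w : B), Tendsto v atTop (𝓝 0) →
      Tendsto (fun n => S (v n)) atTop (𝓝 w) → w + star w = 0 := by
    intro v w hv hw
    refine wld_closable S hd (fun n => v n + star (v n))
      (fun n => IsSelfAdjoint.add_star_self _) _ (IsSelfAdjoint.add_star_self _) ?_ ?_
    · simpa using hv.add hv.star
    · simpa [hs] using hw.add hw.star
  have hv : Tendsto (fun n => u n - x) atTop (𝓝 0) := by simpa using hu.sub_const x
  have hw : Tendsto (fun n => S (u n - x)) atTop (𝓝 (y - S x)) := by
    simpa using hSu.sub_const (S x)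
  have k1 := key _ _ hv hw
  have k2 := key (fun n => Complex.I • (u n - x)) (Complex.I • (y - S x))
    (by simpa using hv.const_smul Complex.I)
    (by simpa only [map_smul] using hw.const_smul Complex.I)
  rw [← sub_eq_zero]
  generalize y - S x = w at k1 k2
  rw [star_smul, eq_neg_of_add_eq_zero_right k1] at k2
  simp only [Complex.star_def, Complex.conj_I] at k2
  have : (2 * Complex.I) • w = 0 := by rw [← k2]; module
  simpa using this

theorem wld_main (T : B → B) (hT : IsWeakLocalDerivation T) : Continuous T := by
  nontriviality B
  let T' : B →ₗ[ℂ] B := hT.1.mk' T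
  let U : B →ₗ[ℂ] B :=
    { toFun := fun a => star (T (star a))
      map_add' := fun a b => by simp [hT.1.map_add]
      map_smul' := fun c a => by simp [hT.1.map_smul] }
  have gen : ∀ c : ℂ, Continuous (c • T' + star c • U) := by
    intro c
    refine wld_cont_star _ (fun a => ?_) (fun x hx μ => ?_)
    · simp [T', U, add_comm]
    · obtain ⟨φ, h1, h2, h3, h4⟩ := wld_state x hx
      obtain ⟨D, hD, e⟩ := hT.2 x φ h1
      rw [h4 D hD] at e
      have z : φ ((c • T' + star c • U) x) = 0 := by
        simp [T', U, hx.star_eq, h3, e]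
      have := φ.le_opNorm (x + (μ : ℂ) • (c • T' + star c • U) x)
      rw [map_add, map_smul, z, h1.1] at this
      simpa [h2] using this
  have h := ((gen 1).sub ((gen Complex.I).const_smul Complex.I)).const_smul (1 / 2 : ℂ)
  convert h using 1
  funext a
  simp only [LinearMap.add_apply, LinearMap.smul_apply, Complex.star_def, Complex.conj_I, map_one,
    one_smul, smul_add, smul_sub, smul_smul]
  simp
  change T' a = _
  have hI : (2 : ℂ)⁻¹ * Complex.I * Complex.I = -2⁻¹ := by
    rw [mul_assoc, Complex.I_mul_I]; ring
  rw [smul_smul, smul_smul, hI]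
  module

end CStarAux

theorem weak_local_derivation_continuous (T : A → A)
    (hT : IsWeakLocalDerivation T) : Continuous T := by
  let _ : CStarAlgebra A := {}
  exact wld_main T hT
end

section
/- Every symmetric weak-local derivation T on a C*-algebra A restricts to a dissipative map on the self-adjoint part A_sa: for every norm-one a ∈ A_sa and every norm-one φ ∈ (A_sa)* with φ(a) = 1, one has Re φ(T(a)) ≤ 0. -/
open scoped ComplexOrder

variable {A : Type*} [NormedRing A] [StarRing A] [CStarRing A] [CompleteSpace A]
  [NormedAlgebra ℂ A] [StarModule ℂ A]

section Helpers

lemma riesz_ext_aux {V E : Type*} [AddCommGroup V] [Module ℝ V] [AddCommGroup E] [Module ℝ E]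
    (s : PointedCone ℝ E) (L : V →ₗ[ℝ] E) (hL : Function.Injective L) (f : V →ₗ[ℝ] ℝ)
    (nonneg : ∀ v, L v ∈ s → 0 ≤ f v) (dense : ∀ y, ∃ v, L v + y ∈ s) :
    ∃ g : E →ₗ[ℝ] ℝ, (∀ v, g (L v) = f v) ∧ ∀ x ∈ s, 0 ≤ g x := by
  let e := LinearEquiv.ofInjective L hL
  let F : E →ₗ.[ℝ] ℝ := ⟨LinearMap.range L, f.comp e.symm.toLinearMap⟩
  have hF : ∀ v, F (e v) = f v := by
    intro v
    change f (e.symm (e v)) = f v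
    simp
  obtain ⟨g, hg1, hg2⟩ := riesz_extension s F
    (by
      intro x hx
      obtain ⟨v, rfl⟩ := e.surjective x
      rw [hF]
      exact nonneg v hx)
    (by
      intro y
      obtain ⟨v, hv⟩ := dense y
      exact ⟨e v, hv⟩)
  refine ⟨g, fun v => ?_, hg2⟩
  rw [← hF v, ← hg1 (e v)]
  rfl

lemma state_mul_zero {B : Type*} [CStarAlgebra B] (ψ : B →L[ℂ] ℂ) (hψ : IsState ψ)
    (b : B) (hb : IsSelfAdjoint b) (h0 : ψ (b * b) = 0) (y : B) :
    ψ (y * b) = 0 ∧ ψ (b * y) = 0 := by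
  have key : ∀ y : B, ψ (y * b) + ψ (b * star y) = 0 := by
    intro y
    have h : ∀ t : ℝ, 0 ≤ ψ (y * star y) + (t : ℂ) * (ψ (y * b) + ψ (b * star y)) := by
      intro t
      have h1 := hψ.2 (star y + (t : ℂ) • b)
      have h2 : star (star y + (t : ℂ) • b) * (star y + (t : ℂ) • b)
          = y * star y + (t : ℂ) • (y * b + b * star y) + ((t : ℂ) * t) • (b * b) := by
        simp only [star_add, star_star, star_smul, hb.star_eq, Complex.star_def,
          Complex.conj_ofReal, add_mul, mul_add, smul_mul_assoc, mul_smul_comm, smul_add,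
          smul_smul]
        abel
      rw [h2] at h1
      simpa [h0, mul_add] using h1
    set p := ψ (y * star y)
    set q := ψ (y * b) + ψ (b * star y)
    have hre : ∀ t : ℝ, 0 ≤ p.re + t * q.re := by
      intro t
      have := (Complex.le_def.1 (h t)).1
      simpa using this
    have him : ∀ t : ℝ, p.im + t * q.im = 0 := by
      intro t
      have := (Complex.le_def.1 (h t)).2
      simpa using this.symm
    apply Complex.ext
    · by_contra hne
      have hne' : q.re ≠ 0 := by simpa using hne
      have := hre (-(p.re + 1) / q.re)
      rw [div_mul_cancel₀ _ hne'] at this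
      linarith
    · have h1 := him 0
      have h2 := him 1
      simp only [Complex.zero_im]
      linarith
  have all : ∀ y : B, ψ (y * b) = 0 ∧ ψ (b * star y) = 0 := by
    intro y
    have h1 := key y
    have h2 := key (Complex.I • y)
    simp only [star_smul, smul_mul_assoc, mul_smul_comm, map_smul, smul_eq_mul,
      Complex.star_def, Complex.conj_I] at h2
    have h3 : ψ (y * b) - ψ (b * star y) = 0 := by
      have : Complex.I * (ψ (y * b) - ψ (b * star y)) = 0 := by
        rw [← h2]; ring
      exact (mul_eq_zero.1 this).resolve_left Complex.I_ne_zero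
    constructor
    · linear_combination (h1 + h3) / 2
    · linear_combination (h1 - h3) / 2
  refine ⟨(all y).1, ?_⟩
  have := (all (star y)).2
  rwa [star_star] at this

lemma wld_deriv_one {B : Type*} [CStarAlgebra B] (D : B → B) (hD : IsDerivation D) : D 1 = 0 := by
  have := hD.2 1 1
  simpa using this

lemma state_wld_zero {B : Type*} [CStarAlgebra B] [PartialOrder B] [StarOrderedRing B]
    (T : B → B) (hT : IsWeakLocalDerivation T)
    (ψ : B →L[ℂ] ℂ) (hψ : IsState ψ) (a : B) (ha : 0 ≤ 1 - a) (h1 : ψ (1 - a) = 0) :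
    ψ (T a) = 0 := by
  obtain ⟨D, hD, hDa⟩ := hT.2 a ψ hψ
  obtain ⟨b, hb, hab⟩ :=
    CStarAlgebra.nonneg_iff_exists_isSelfAdjoint_and_eq_mul_self.1 ha
  have h2 := state_mul_zero ψ hψ b hb (by rw [← hab]; exact h1) (D b)
  have h3 : D (1 - a) = D 1 - D a := hD.1.map_sub 1 a
  rw [wld_deriv_one D hD, hab, hD.2, zero_sub] at h3
  have h4 : D a = -(D b * b + b * D b) := by rw [h3, neg_neg]
  rw [hDa, h4, map_neg, map_add, h2.1, h2.2]
  simp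

lemma pos_bound {B : Type*} [CStarAlgebra B] [PartialOrder B] [StarOrderedRing B]
    (f : selfAdjoint B →ₗ[ℝ] ℝ) (hf : ∀ x : selfAdjoint B, 0 ≤ (x : B) → 0 ≤ f x)
    (x : selfAdjoint B) : |f x| ≤ ‖x‖ * f 1 := by
  have e1 : algebraMap ℝ B ‖(x : B)‖ = ((‖x‖ • (1 : selfAdjoint B) : selfAdjoint B) : B) := by
    rw [Algebra.algebraMap_eq_smul_one]; rfl
  have h1 := IsSelfAdjoint.le_algebraMap_norm_self (a := (x : B)) x.2
  have h2 := IsSelfAdjoint.neg_algebraMap_norm_le_self (a := (x : B)) x.2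
  rw [e1] at h1 h2
  have h3 := hf (‖x‖ • 1 - x) (by
    rw [AddSubgroupClass.coe_sub]; exact sub_nonneg.2 h1)
  have h4 := hf (‖x‖ • 1 + x) (by
    rw [AddMemClass.coe_add]; exact neg_le_iff_add_nonneg'.1 h2)
  rw [map_sub, map_smul, smul_eq_mul] at h3
  rw [map_add, map_smul, smul_eq_mul] at h4
  rw [abs_le]
  constructor <;> linarith

lemma exists_state {B : Type*} [CStarAlgebra B] [PartialOrder B] [StarOrderedRing B]
    [Nontrivial B]
    (f : selfAdjoint B →ₗ[ℝ] ℝ) (hf : ∀ x : selfAdjoint B, 0 ≤ (x : B) → 0 ≤ f x)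
    (hf1 : f 1 = 1) :
    ∃ ψ : B →L[ℂ] ℂ, IsState ψ ∧ ∀ x : selfAdjoint B, ψ (x : B) = (f x : ℂ) := by
  let F : Module.Dual ℝ B := f.comp realPart
  let G : Module.Dual ℂ B := F.extendRCLike
  have hF : ∀ x, |F x| ≤ ‖x‖ := by
    intro x
    have := pos_bound f hf (realPart x)
    rw [hf1, mul_one] at this
    exact this.trans (realPart.norm_le x)
  have hG : ∀ x : selfAdjoint B, G (x : B) = (f x : ℂ) := by
    intro x
    have := Module.Dual.extendRCLike_apply (𝕜 := ℂ) F (x : B)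
    rw [this]
    have i1 : F (x : B) = f x := by
      change f (realPart (x : B)) = f x
      rw [selfAdjoint.realPart_coe]
    have i2 : F ((RCLike.I : ℂ) • (x : B)) = 0 := by
      change f (realPart (Complex.I • (x : B))) = 0
      rw [realPart_I_smul]
      have : imaginaryPart (x : B) = 0 := x.2.imaginaryPart
      rw [this]; simp
    rw [i1, i2]; simp
  have hGn : ∀ x, ‖G x‖ ≤ 1 * ‖x‖ := by
    intro x
    rw [one_mul]
    have h := Module.Dual.norm_extendRCLike_apply_sq (𝕜 := ℂ) F x
    have h2 : ‖G x‖ ^ 2 ≤ ‖G x‖ * ‖x‖ := by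
      calc ‖G x‖ ^ 2 = _ := h
        _ ≤ _ := (le_abs_self _).trans (hF _)
        _ = _ := by rw [norm_smul, RCLike.norm_conj]
    by_cases h0 : ‖G x‖ = 0
    · rw [h0]; positivity
    · have : 0 < ‖G x‖ := lt_of_le_of_ne (norm_nonneg _) (Ne.symm h0)
      nlinarith
  refine ⟨G.mkContinuous 1 hGn, ⟨?_, ?_⟩, hG⟩
  · apply le_antisymm
    · exact G.mkContinuous_norm_le zero_le_one hGn
    · have h := (G.mkContinuous 1 hGn).le_opNorm 1
      have h1 : (G.mkContinuous 1 hGn) 1 = 1 := by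
        have := hG 1
        rw [hf1] at this
        simpa using this
      rw [h1] at h
      simpa using h
  · intro a
    have := hG ⟨star a * a, IsSelfAdjoint.star_mul_self a⟩
    change 0 ≤ G (star a * a)
    rw [show G (star a * a) = _ from this]
    exact_mod_cast hf _ (star_mul_self_nonneg a)

lemma pos_wld_zero {B : Type*} [CStarAlgebra B] [PartialOrder B] [StarOrderedRing B]
    [Nontrivial B] (T : B → B) (hT : IsWeakLocalDerivation T)
    (f : selfAdjoint B →ₗ[ℝ] ℝ) (hf : ∀ x : selfAdjoint B, 0 ≤ (x : B) → 0 ≤ f x)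
    (a : selfAdjoint B) (ha : 0 ≤ 1 - (a : B)) (h1 : f (1 - a) = 0)
    (c : selfAdjoint B) (hc : (c : B) = T a) : f c = 0 := by
  by_cases h0 : f 1 = 0
  · have := pos_bound f hf c
    rw [h0, mul_zero] at this
    exact abs_eq_zero.1 (le_antisymm this (abs_nonneg _))
  · have hpos : 0 < f 1 := lt_of_le_of_ne (hf 1 (by simp)) (Ne.symm h0)
    obtain ⟨ψ, hψ, hψf⟩ := exists_state ((f 1)⁻¹ • f)
      (fun x hx => mul_nonneg (inv_nonneg.2 hpos.le) (hf x hx)) (inv_mul_cancel₀ h0)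
    have h2 := hψf (1 - a)
    rw [LinearMap.smul_apply, h1] at h2
    have h3 := state_wld_zero T hT ψ hψ a ha (by simpa using h2)
    rw [← hc, hψf c] at h3
    simpa [h0] using h3

lemma main_aux {B : Type*} [CStarAlgebra B] [PartialOrder B] [StarOrderedRing B]
    (T : B → B)
    (hT : IsWeakLocalDerivation T) (hsym : ∀ a : B, star (T (star a)) = T a)
    (a : B) (ha : IsSelfAdjoint a) (hnorm : ‖a‖ = 1)
    (φ : B →ₗ[ℝ] ℝ) (hφ : ∀ b : B, IsSelfAdjoint b → |φ b| ≤ ‖b‖) (hφa : φ a = 1) :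
    φ (T a) ≤ 0 := by
  haveI : Nontrivial B := ⟨a, 0, fun h => by simp [h] at hnorm⟩
  have hTa : IsSelfAdjoint (T a) := by
    have := hsym a
    rwa [ha.star_eq] at this
  let S := selfAdjoint B
  let s : PointedCone ℝ (S × S) :=
    { carrier := {p | 0 ≤ (p.1 : B) ∧ 0 ≤ (p.2 : B)}
      add_mem' := fun {p q} hp hq => ⟨add_nonneg hp.1 hq.1, add_nonneg hp.2 hq.2⟩
      zero_mem' := ⟨le_refl _, le_refl _⟩
      smul_mem' := fun c p hp => ⟨smul_nonneg c.2 hp.1, smul_nonneg c.2 hp.2⟩ }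
  let l1 : ℝ × S →ₗ[ℝ] S := (LinearMap.fst ℝ ℝ S).smulRight 1
  let l2 : ℝ × S →ₗ[ℝ] S := LinearMap.snd ℝ ℝ S
  let L : ℝ × S →ₗ[ℝ] S × S := (l1 + l2).prod (l1 - l2)
  have hLv : ∀ v : ℝ × S, L v = (v.1 • 1 + v.2, v.1 • 1 - v.2) := fun v => rfl
  let φS : S →ₗ[ℝ] ℝ :=
    { toFun := fun x => φ (x : B)
      map_add' := fun x y => φ.map_add _ _
      map_smul' := fun c x => φ.map_smul c _ }
  let f : ℝ × S →ₗ[ℝ] ℝ := LinearMap.fst ℝ ℝ S + φS.comp l2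
  have hfv : ∀ v : ℝ × S, f v = v.1 + φ (v.2 : B) := fun v => rfl
  have hL : Function.Injective L := by
    rw [injective_iff_map_eq_zero]
    rintro ⟨r, x⟩ h
    rw [hLv, Prod.mk_eq_zero] at h
    obtain ⟨h1, h2⟩ := h
    simp only at h1 h2
    have h3 : (2 * r) • (1 : S) = 0 := by
      have : (2 * r) • (1 : S) = (r • 1 + x) + (r • 1 - x) := by
        rw [two_mul, add_smul]; abel
      rw [this, h1, h2, add_zero]
    have hr : r = 0 := by
      rcases smul_eq_zero.1 h3 with h | h
      · linarith
      · exact absurd (congrArg (Subtype.val) h) one_ne_zero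
    rw [hr, zero_smul, zero_add] at h1
    rw [hr, h1]; rfl
  have amap : ∀ r : ℝ, algebraMap ℝ B r = ((r • (1 : S) : S) : B) := by
    intro r
    rw [Algebra.algebraMap_eq_smul_one]; rfl
  have hnonneg : ∀ v, L v ∈ s → 0 ≤ f v := by
    rintro ⟨r, x⟩ h
    rw [hLv] at h
    rw [hfv]
    obtain ⟨h1, h2⟩ := h
    have h1' : 0 ≤ algebraMap ℝ B r + (x : B) := by rw [amap]; exact h1
    have h2' : 0 ≤ algebraMap ℝ B r - (x : B) := by rw [amap]; exact h2
    have hx : IsSelfAdjoint (x : B) := x.2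
    have hxr : ‖(x : B)‖ ≤ r := by
      rcases CStarAlgebra.norm_or_neg_norm_mem_spectrum (a := (x : B)) hx with h | h
      · exact (le_algebraMap_iff_spectrum_le (a := (x : B)) hx).1 (sub_nonneg.1 h2') _ h
      · have := (algebraMap_le_iff_le_spectrum (a := (x : B)) (r := -r) hx).1
          (by rw [map_neg]; exact neg_le_iff_add_nonneg'.2 h1') _ h
        linarith
    have := (abs_le.1 (hφ x hx)).1
    simp only
    linarith
  have hdense : ∀ y, ∃ v, L v + y ∈ s := by
    rintro ⟨y, z⟩
    refine ⟨(‖y‖ + ‖z‖, 0), ?_⟩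
    have hone : (0 : B) ≤ 1 := zero_le_one
    have hh : ∀ (y : S) (r : ℝ), 0 ≤ r → 0 ≤ (((‖y‖ + r) • (1 : S) + y : S) : B) := by
      intro y r hr
      have h2 := IsSelfAdjoint.neg_algebraMap_norm_le_self (a := (y : B)) y.2
      have h3 := neg_le_iff_add_nonneg'.1 h2
      have h4 : (((‖y‖ + r) • (1 : S) + y : S) : B)
          = (algebraMap ℝ B ‖(y : B)‖ + (y : B)) + r • (1 : B) := by
        rw [Algebra.algebraMap_eq_smul_one]
        change (‖y‖ + r) • (1 : B) + (y : B) = (‖y‖ • (1 : B) + y) + r • (1 : B)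
        rw [add_smul]; abel
      rw [h4]
      exact add_nonneg h3 (smul_nonneg hr hone)
    rw [hLv]
    simp only [add_zero, sub_zero]
    refine ⟨hh y _ (norm_nonneg _), ?_⟩
    have := hh z ‖y‖ (norm_nonneg _)
    rw [add_comm ‖z‖] at this
    exact this
  obtain ⟨g, hg, hgs⟩ := riesz_ext_aux s L hL f hnonneg hdense
  let f1 : S →ₗ[ℝ] ℝ := g.comp (LinearMap.inl ℝ S S)
  let f2 : S →ₗ[ℝ] ℝ := g.comp (LinearMap.inr ℝ S S)
  have hf1 : ∀ x : S, 0 ≤ (x : B) → 0 ≤ f1 x := fun x hx => hgs _ ⟨hx, le_refl _⟩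
  have hf2 : ∀ x : S, 0 ≤ (x : B) → 0 ≤ f2 x := fun x hx => hgs _ ⟨le_refl _, hx⟩
  have hsplit : ∀ x y : S, g (x, y) = f1 x + f2 y := by
    intro x y
    change g (x, y) = g (x, 0) + g (0, y)
    rw [← map_add]; simp
  have hone : f1 1 + f2 1 = 1 := by
    have := hg (1, 0)
    rw [hLv, hfv, hsplit] at this
    simpa using this
  have hsub : ∀ x : S, f1 x - f2 x = φ (x : B) := by
    intro x
    have := hg (0, x)
    rw [hLv, hfv, hsplit] at this
    simpa [sub_eq_add_neg] using this
  let a' : S := ⟨a, ha⟩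
  let c : S := ⟨T a, hTa⟩
  have ha1 : a ≤ 1 := by
    have := IsSelfAdjoint.le_algebraMap_norm_self (a := a) ha
    simpa [hnorm] using this
  have ha2 : -1 ≤ a := by
    have := IsSelfAdjoint.neg_algebraMap_norm_le_self (a := a) ha
    simpa [hnorm] using this
  have p1 : (0 : B) ≤ 1 - ((a' : S) : B) := sub_nonneg.2 ha1
  have p2 : (0 : B) ≤ 1 - ((-a' : S) : B) := by
    change (0 : B) ≤ 1 - (-a)
    rw [sub_neg_eq_add]; exact neg_le_iff_add_nonneg'.1 ha2
  have q1 : 0 ≤ f1 (1 - a') := hf1 _ p1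
  have q2 : 0 ≤ f2 (1 - (-a')) := hf2 _ p2
  have q3 : f1 (1 - a') + f2 (1 - (-a')) = 0 := by
    have := hsub a'
    rw [show φ (a' : B) = 1 from hφa] at this
    rw [map_sub, map_sub, map_neg]
    linarith
  have r1 : f1 c = 0 := pos_wld_zero T hT f1 hf1 a' p1 (by linarith) c rfl
  have r2 : f2 (-c) = 0 := pos_wld_zero T hT f2 hf2 (-a') p2 (by linarith) (-c)
    (by
      change -T a = T (-a)
      rw [hT.1.map_neg])
  rw [map_neg] at r2
  have := hsub c
  change f1 c - f2 c = φ (T a) at this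
  linarith

end Helpers

/-- A symmetric weak-local derivation is dissipative on the self-adjoint part: for a norm-one
self-adjoint `a` and a norm-one real functional `φ` on `A_sa` with `φ a = 1`, `φ (T a) ≤ 0`. -/
theorem symmetric_weak_local_derivation_dissipative (T : A → A)
    (hT : IsWeakLocalDerivation T) (hsym : ∀ a : A, star (T (star a)) = T a)
    (a : A) (ha : IsSelfAdjoint a) (hnorm : ‖a‖ = 1)
    (φ : A →ₗ[ℝ] ℝ) (hφ : ∀ b : A, IsSelfAdjoint b → |φ b| ≤ ‖b‖) (hφa : φ a = 1) :
    φ (T a) ≤ 0 := by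
  letI : CStarAlgebra A := { }
  letI := CStarAlgebra.spectralOrder A
  haveI := CStarAlgebra.spectralOrderedRing A
  exact main_aux T hT hsym a ha hnorm φ hφ hφa
end

section
/- Let B be a commutative von Neumann subalgebra of a von Neumann algebra M containing the unit of M, let (p_n) be a sequence of non-zero mutually orthogonal projections in B, and let T : B → M be a linear left-annihilator-preserving map. Then the map a ↦ p_n T(a) is continuous for all but finitely many n. -/
open scoped ComplexOrder InnerProductSpace

variable {H : Type*} [NormedAddCommGroup H] [InnerProductSpace ℂ H] [CompleteSpace H]

instance : SMulMemClass (VonNeumannAlgebra H) ℂ (H →L[ℂ] H) :=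
  ⟨fun {s} c {x} hx => s.toStarSubalgebra.smul_mem hx c⟩

/-- A normal state on `B(H)`, given in density-matrix form `φ(x) = ∑ ⟨x ξₙ, ξₙ⟩` with
`∑ ‖ξₙ‖² = 1`.  The normal states of a von Neumann algebra `M ⊆ B(H)` are exactly the
restrictions to `M` of such functionals. -/
def IsNormalState (φ : (H →L[ℂ] H) → ℂ) : Prop :=
  ∃ ξ : ℕ → H, (∑' n, ‖ξ n‖ ^ 2) = 1 ∧ ∀ x : H →L[ℂ] H, φ x = ∑' n, ⟪ξ n, x (ξ n)⟫_ℂ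

/-- A derivation on the von Neumann algebra `M`. -/
def IsDerivationOn (M : VonNeumannAlgebra H) (D : ↥M → ↥M) : Prop :=
  IsLinearMap ℂ D ∧ ∀ a b : ↥M, D (a * b) = D a * b + a * D b

/-- A weak*-local derivation on the von Neumann algebra `M`: a linear map agreeing with some
derivation at each point, up to each normal state. -/
def IsWeakStarLocalDerivation (M : VonNeumannAlgebra H) (T : ↥M → ↥M) : Prop :=
  IsLinearMap ℂ T ∧ ∀ (a : ↥M) (φ : (H →L[ℂ] H) → ℂ), IsNormalState φ →
    ∃ D : ↥M → ↥M, IsDerivationOn M D ∧ φ ↑(T a) = φ ↑(D a)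

theorem aux_ker_proj (B : VonNeumannAlgebra H) (a : H →L[ℂ] H) (ha : a ∈ B) :
    ∃ P ∈ B, IsStarProjection P ∧ a * P = 0 ∧ ∀ ξ, a ξ = 0 → P ξ = ξ := by
  have : CompleteSpace (LinearMap.ker (a : H →ₗ[ℂ] H)) := a.isClosed_ker.completeSpace_coe
  refine ⟨(LinearMap.ker (a : H →ₗ[ℂ] H)).starProjection, ?_, isStarProjection_starProjection, ?_, ?_⟩
  · rw [VonNeumannAlgebra.IsStarProjection.mem_iff isStarProjection_starProjection]
    intro y hy
    rw [VonNeumannAlgebra.mem_commutant_iff] at hy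
    have := hy a ha
    rw [Submodule.range_starProjection, Module.End.mem_invtSubmodule]
    intro ξ hξ
    have h2 := DFunLike.congr_fun this ξ
    simp only [LinearMap.mem_ker, Submodule.mem_comap, mul_apply_eq_comp, ContinuousLinearMap.coe_coe] at *
    rw [h2, hξ, map_zero]
  · ext ξ
    have := Submodule.starProjection_apply_mem (LinearMap.ker (a : H →ₗ[ℂ] H)) ξ
    exact LinearMap.mem_ker.1 this
  · intro ξ hξ
    rw [Submodule.starProjection_eq_self_iff]
    simpa using hξ

theorem aux_half (B : VonNeumannAlgebra H) (x : H →L[ℂ] H) (hx : x ∈ B) (h0 : 0 ≤ x) (h1 : x ≤ 1) :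
    ∃ q ∈ B, IsStarProjection q ∧ ∃ r ∈ B, 0 ≤ r ∧ r ≤ 1 ∧ x + x = q + r := by
  have hsa : IsSelfAdjoint (x + x - 1) :=
    ((IsSelfAdjoint.of_nonneg h0).add (IsSelfAdjoint.of_nonneg h0)).sub (.one _)
  have hzB : x + x - 1 ∈ B := sub_mem (add_mem hx hx) (one_mem B)
  obtain ⟨a, b, ha0, hb0, hab, hmul, haB⟩ : ∃ a b : H →L[ℂ] H, 0 ≤ a ∧ 0 ≤ b ∧ x + x - 1 = a - b ∧
      a * b = 0 ∧ a ∈ B := by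
    refine ⟨(x + x - 1)⁺, (x + x - 1)⁻, CFC.posPart_nonneg _, CFC.negPart_nonneg _,
      (CFC.posPart_sub_negPart _ hsa).symm, CFC.posPart_mul_negPart _, ?_⟩
    rw [← B.commutant_commutant, VonNeumannAlgebra.mem_commutant_iff]
    intro g hg
    rw [VonNeumannAlgebra.mem_commutant_iff] at hg
    have h : Commute (x + x - 1) g := hg _ hzB
    exact (h.cfcₙ_real _).symm.eq
  obtain ⟨P, hPB, hP, haP, hPk⟩ := aux_ker_proj B a haB
  have hPb : P * b = b := by
    ext ξ
    exact hPk _ (DFunLike.congr_fun hmul ξ)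
  have hPs : star P = P := hP.isSelfAdjoint
  have hPP : P * P = P := hP.isIdempotentElem
  have has : star a = a := (IsSelfAdjoint.of_nonneg ha0)
  have hbs : star b = b := (IsSelfAdjoint.of_nonneg hb0)
  have hPa : P * a = 0 := by simpa [hPs, has] using congrArg star haP
  have hbP : b * P = b := by simpa [hPs, hbs] using congrArg star hPb
  have hxx : x + x = 1 + a - b := by rw [add_sub_assoc, ← hab]; abel
  refine ⟨1 - P, sub_mem (one_mem B) hPB, hP.one_sub, P + (x + x - 1),
    add_mem hPB hzB, ?_, ?_, by abel⟩
  · have e : P + (x + x - 1) = star P * (x + x) * P + a := by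
      rw [hPs, hxx]
      simp only [mul_add, mul_sub, add_mul, sub_mul, mul_one, hPP, hPa, hPb, hbP, zero_mul]
      abel
    rw [e]
    exact add_nonneg (star_left_conjugate_nonneg (add_nonneg h0 h0) P) ha0
  · rw [← sub_nonneg]
    have e : 1 - (P + (x + x - 1)) = star (1 - P) * ((1 - x) + (1 - x)) * (1 - P) + b := by
      have : (1 - x) + (1 - x) = 1 - a + b := by
        have : (1 - x) + (1 - x) = 1 + 1 - (x + x) := by abel
        rw [this, hxx]; abel
      rw [this, star_sub, star_one, hPs, hxx]
      simp only [mul_add, mul_sub, add_mul, sub_mul, mul_one, one_mul, hPP, hPa, hPb, hbP, haP, zero_mul]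
      abel
    rw [e]
    exact add_nonneg (star_left_conjugate_nonneg (add_nonneg (sub_nonneg.2 h1) (sub_nonneg.2 h1)) _) hb0

theorem aux_seq {α : Type*} (I : ℕ → α → Prop) (R : ℕ → α → α → Prop) (s0 : α) (h0 : I 0 s0)
    (hs : ∀ k s, I k s → ∃ s', I (k + 1) s' ∧ R k s s') :
    ∃ u : ℕ → α, (∀ k, I k (u k)) ∧ ∀ k, R k (u k) (u (k + 1)) := by
  choose! g hg1 hg2 using hs
  have h : ∀ k, I k (Nat.rec (motive := fun _ => α) s0 (fun k s => g k s) k) := by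
    intro k
    induction k with
    | zero => exact h0
    | succ k ih => exact hg1 _ _ ih
  exact ⟨fun k => Nat.rec (motive := fun _ => α) s0 (fun k s => g k s) k, h, fun k => hg2 _ _ (h k)⟩

/-- The properties of the map `S = T - T(1) ·` used in the argument. -/
structure AuxLoc (B : VonNeumannAlgebra H) (S : (H →L[ℂ] H) → (H →L[ℂ] H)) : Prop where
  add : ∀ x ∈ B, ∀ y ∈ B, S (x + y) = S x + S y
  smul : ∀ c : ℂ, ∀ x ∈ B, S (c • x) = c • S x
  proj : ∀ x ∈ B, ∀ p ∈ B, IsStarProjection p → S (x * p) = S x * p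
  one : S 1 = 0

theorem AuxLoc.apply_proj {B : VonNeumannAlgebra H} {S : (H →L[ℂ] H) → (H →L[ℂ] H)}
    (h : AuxLoc B S) {p : H →L[ℂ] H} (hp : p ∈ B) (hpp : IsStarProjection p) : S p = 0 := by
  have := h.proj 1 (one_mem B) p hp hpp
  rwa [one_mul, h.one, zero_mul] at this

theorem AuxLoc.double {B : VonNeumannAlgebra H} {S : (H →L[ℂ] H) → (H →L[ℂ] H)}
    (h : AuxLoc B S) {x : H →L[ℂ] H} (hx : x ∈ B) (h0 : 0 ≤ x) (h1 : x ≤ 1) (k : ℕ) :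
    ∃ r ∈ B, 0 ≤ r ∧ r ≤ 1 ∧ S r = (2 ^ k : ℂ) • S x := by
  induction k with
  | zero => exact ⟨x, hx, h0, h1, by simp⟩
  | succ k ih =>
    obtain ⟨r, hr, hr0, hr1, e⟩ := ih
    obtain ⟨q, hq, hqp, s, hs, hs0, hs1, e2⟩ := aux_half B r hr hr0 hr1
    refine ⟨s, hs, hs0, hs1, ?_⟩
    have h3 := congrArg S e2
    rw [h.add _ hr _ hr, h.add _ hq _ hs, h.apply_proj hq hqp, zero_add] at h3
    rw [← h3, e, pow_succ, mul_two, add_smul]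

theorem aux_tsum_mem (B : VonNeumannAlgebra H) (v : ℕ → H →L[ℂ] H) (hv : ∀ k, v k ∈ B)
    (hs : Summable v) : ∑' k, v k ∈ B := by
  rw [← B.commutant_commutant, VonNeumannAlgebra.mem_commutant_iff]
  intro g hg
  rw [VonNeumannAlgebra.mem_commutant_iff] at hg
  rw [← hs.tsum_mul_left, ← hs.tsum_mul_right]
  exact tsum_congr fun k => (hg _ (hv k)).symm

theorem aux_proj_norm {p : H →L[ℂ] H} (hp : IsStarProjection p) : ‖p‖ ≤ 1 := hp.norm_le

theorem AuxLoc.hump {B : VonNeumannAlgebra H} {S : (H →L[ℂ] H) → (H →L[ℂ] H)}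
    (h : AuxLoc B S) {x : H →L[ℂ] H} (hx : x ∈ B) (h0 : 0 ≤ x) (h1 : x ≤ 1)
    (d : ℕ → H →L[ℂ] H) (hd : ∀ k, d k ∈ B) (hdp : ∀ k, IsStarProjection (d k))
    (horth : ∀ j k, j ≠ k → d j * d k = 0) : ∃ N, ∀ k, N ≤ k → S x * d k = 0 := by
  have hex : ∀ k : ℕ, ∃ r ∈ B, ‖r‖ ≤ 1 ∧ (S x * d k ≠ 0 → 2 ^ k * (k : ℝ) ≤ ‖S r * d k‖) := by
    intro k
    by_cases hz : S x * d k = 0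
    · exact ⟨x, hx, (CStarAlgebra.norm_le_one_iff_of_nonneg x h0).2 h1, fun h => absurd hz h⟩
    · have hpos : 0 < ‖S x * d k‖ := norm_pos_iff.2 hz
      obtain ⟨m, hm⟩ := pow_unbounded_of_one_lt (2 ^ k * (k : ℝ) / ‖S x * d k‖) (one_lt_two)
      obtain ⟨r, hr, hr0, hr1, e⟩ := h.double hx h0 h1 m
      refine ⟨r, hr, (CStarAlgebra.norm_le_one_iff_of_nonneg r hr0).2 hr1, fun _ => ?_⟩
      rw [e, smul_mul_assoc, norm_smul, norm_pow, Complex.norm_ofNat]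
      rw [div_lt_iff₀ hpos] at hm
      exact hm.le
  choose r hr hrn hrS using hex
  set v : ℕ → H →L[ℂ] H := fun k => ((1 / 2 : ℂ) ^ k) • (r k * d k) with hvdef
  have hvB : ∀ k, v k ∈ B := fun k => SMulMemClass.smul_mem _ (mul_mem (hr k) (hd k))
  have hvs : Summable v := by
    refine Summable.of_norm_bounded (g := fun k : ℕ => (1 / 2 : ℝ) ^ k) summable_geometric_two ?_
    intro k
    rw [hvdef]
    simp only
    rw [norm_smul, norm_pow]
    have : ‖r k * d k‖ ≤ 1 := (norm_mul_le _ _).trans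
      (mul_le_one₀ (hrn k) (norm_nonneg _) (aux_proj_norm (hdp k)))
    have e : ‖(1 / 2 : ℂ)‖ = 1 / 2 := by simp
    rw [e]
    exact mul_le_of_le_one_right (by positivity) this
  have hwB := aux_tsum_mem B v hvB hvs
  set w := ∑' k, v k with hw
  have hwd : ∀ k, w * d k = ((1 / 2 : ℂ) ^ k) • (r k * d k) := by
    intro k
    rw [hw, ← hvs.tsum_mul_right, tsum_eq_single k]
    · simp only [hvdef]
      rw [smul_mul_assoc, mul_assoc, (hdp k).isIdempotentElem.eq]
    · intro j hj
      simp only [hvdef]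
      rw [smul_mul_assoc, mul_assoc, horth j k hj, mul_zero, smul_zero]
  have hSw : ∀ k, S w * d k = ((1 / 2 : ℂ) ^ k) • (S (r k) * d k) := by
    intro k
    rw [← h.proj _ hwB _ (hd k) (hdp k), hwd k, h.smul _ _ (mul_mem (hr k) (hd k)),
      h.proj _ (hr k) _ (hd k) (hdp k)]
  obtain ⟨N, hN⟩ := exists_nat_gt ‖S w‖
  refine ⟨N, fun k hk => ?_⟩
  by_contra hne
  have h3 := hrS k hne
  have h4 : ‖S w * d k‖ ≤ ‖S w‖ := (norm_mul_le _ _).trans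
    (mul_le_of_le_one_right (norm_nonneg _) (aux_proj_norm (hdp k)))
  rw [hSw k, norm_smul, norm_pow] at h4
  have e : ‖(1 / 2 : ℂ)‖ = 1 / 2 := by simp
  rw [e] at h4
  have h5 : (1 / 2 : ℝ) ^ k * (2 ^ k * (k : ℝ)) ≤ (1 / 2 : ℝ) ^ k * ‖S (r k) * d k‖ := by gcongr
  rw [← mul_assoc, ← mul_pow] at h5
  norm_num at h5
  have h6 : (N : ℝ) ≤ k := by exact_mod_cast hk
  norm_num at h4
  linarith

theorem AuxLoc.branch {B : VonNeumannAlgebra H} {S : (H →L[ℂ] H) → (H →L[ℂ] H)}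
    (hcomm : ∀ x ∈ B, ∀ y ∈ B, x * y = y * x) (y : H →L[ℂ] H)
    {x : H →L[ℂ] H} (hx : x ∈ B) (h0 : 0 ≤ x) (h1 : x ≤ 1) (hne : y ≠ 0) :
    ∃ (f : ℕ → H →L[ℂ] H) (c : ℕ → ℂ) (r : ℕ → H →L[ℂ] H),
      (∀ k, f k ∈ B ∧ IsStarProjection (f k) ∧ y * f k ≠ 0 ∧ ‖r k‖ ≤ 1 ∧
        x * f k = c k • f k + ((1 / 2 : ℂ) ^ k) • (r k * f k)) ∧
      ∀ k, f k * f (k + 1) = f (k + 1) ∧ ‖c (k + 1) - c k‖ ≤ (1 / 2 : ℝ) ^ k := by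
  let I : ℕ → (H →L[ℂ] H) × ℂ × (H →L[ℂ] H) → Prop := fun k s =>
    s.1 ∈ B ∧ IsStarProjection s.1 ∧ y * s.1 ≠ 0 ∧ (s.2.2 ∈ B ∧ 0 ≤ s.2.2 ∧ s.2.2 ≤ 1) ∧
    x * s.1 = s.2.1 • s.1 + ((1 / 2 : ℂ) ^ k) • (s.2.2 * s.1)
  let R : ℕ → (H →L[ℂ] H) × ℂ × (H →L[ℂ] H) → (H →L[ℂ] H) × ℂ × (H →L[ℂ] H) → Prop :=
    fun k s t => s.1 * t.1 = t.1 ∧ ‖t.2.1 - s.2.1‖ ≤ (1 / 2 : ℝ) ^ k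
  obtain ⟨u, hu1, hu2⟩ := aux_seq I R (1, 0, x)
    ⟨one_mem B, .one _, by simpa using hne, ⟨hx, h0, h1⟩, by simp⟩ (by
    rintro k ⟨f, c, r⟩ ⟨hf, hfp, hyf, ⟨hr, hr0, hr1⟩, e⟩
    simp only at hf hfp hyf hr hr0 hr1 e
    obtain ⟨q, hq, hqp, s, hs, hs0, hs1, e2⟩ := aux_half B r hr hr0 hr1
    have hff := hfp.isIdempotentElem.eq
    have hqq := hqp.isIdempotentElem.eq
    have er : r = (1 / 2 : ℂ) • (q + s) := by
      rw [← e2, ← two_smul ℂ r, smul_smul]; norm_num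
    by_cases hc : y * (f * q) = 0
    · refine ⟨(f * (1 - q), c, s), ⟨mul_mem hf (sub_mem (one_mem B) hq),
        hfp.mul hqp.one_sub (hcomm _ hf _ (sub_mem (one_mem B) hq)), ?_, ⟨hs, hs0, hs1⟩, ?_⟩, ?_, ?_⟩
      · simp only [mul_sub, mul_one, hc, sub_zero]
        exact hyf
      · simp only
        rw [← mul_assoc, e, er, add_mul, pow_succ, smul_mul_assoc, smul_mul_assoc, smul_mul_assoc,
          smul_mul_assoc, smul_smul, add_mul, add_mul, hcomm q hq f hf, mul_assoc f q,
          hqp.mul_one_sub_self, mul_zero, zero_add, mul_assoc s]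
      · simp only [← mul_assoc, hff]
      · simp
    · refine ⟨(f * q, c + (1 / 2 : ℂ) ^ (k + 1), s), ⟨mul_mem hf hq,
        hfp.mul hqp (hcomm _ hf _ hq), hc, ⟨hs, hs0, hs1⟩, ?_⟩, ?_, ?_⟩
      · simp only
        rw [← mul_assoc, e, er, add_mul, pow_succ, smul_mul_assoc, smul_mul_assoc, smul_mul_assoc,
          smul_mul_assoc, smul_smul, add_mul, add_mul, hcomm q hq f hf, mul_assoc f q, hqq,
          mul_assoc s, add_smul, smul_add, add_assoc]
      · simp only [← mul_assoc, hff]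
      · simp only [add_sub_cancel_left, norm_pow]
        have e : ‖(1 / 2 : ℂ)‖ = 1 / 2 := by simp
        rw [e]
        exact pow_le_pow_of_le_one (by norm_num) (by norm_num) (Nat.le_succ k))
  refine ⟨fun k => (u k).1, fun k => (u k).2.1, fun k => (u k).2.2, fun k => ?_, hu2⟩
  obtain ⟨a1, a2, a3, ⟨a4, a5, a6⟩, a7⟩ := hu1 k
  exact ⟨a1, a2, a3, (CStarAlgebra.norm_le_one_iff_of_nonneg _ a5).2 a6, a7⟩

theorem AuxLoc.zero_unit {B : VonNeumannAlgebra H} {S : (H →L[ℂ] H) → (H →L[ℂ] H)}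
    (h : AuxLoc B S) (hcomm : ∀ x ∈ B, ∀ y ∈ B, x * y = y * x)
    {x : H →L[ℂ] H} (hx : x ∈ B) (h0 : 0 ≤ x) (h1 : x ≤ 1) : S x = 0 := by
  by_contra hne
  obtain ⟨f, c, r, hf, hfc⟩ := AuxLoc.branch (S := S) hcomm (S x) hx h0 h1 hne
  have hmono : ∀ j k, j ≤ k → f j * f k = f k := by
    intro j k hjk
    induction k, hjk using Nat.le_induction with
    | base => exact (hf j).2.1.isIdempotentElem.eq
    | succ k hk ih => rw [← (hfc k).1, ← mul_assoc, ih]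
  have hmono' : ∀ j k, j ≤ k → f k * f j = f k := fun j k hjk => by
    rw [hcomm _ (hf k).1 _ (hf j).1, hmono j k hjk]
  have horth : ∀ j k, j < k → (f j - f (j + 1)) * (f k - f (k + 1)) = 0 := by
    intro j k hjk
    simp only [sub_mul, mul_sub]
    rw [hmono j k hjk.le, hmono j (k + 1) (by omega), hmono (j + 1) k hjk,
      hmono (j + 1) (k + 1) (by omega), sub_self, sub_self, sub_self]
  have hdB : ∀ k, f k - f (k + 1) ∈ B := fun k => sub_mem (hf k).1 (hf (k + 1)).1
  obtain ⟨N, hN⟩ := h.hump hx h0 h1 (fun k => f k - f (k + 1)) hdB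
    (fun k => by
      have e : f k - f (k + 1) = f k * (1 - f (k + 1)) := by
        rw [mul_sub, mul_one, (hfc k).1]
      rw [e]
      exact (hf k).2.1.mul (hf (k + 1)).2.1.one_sub
        (hcomm _ (hf k).1 _ (sub_mem (one_mem B) (hf (k + 1)).1)))
    (fun j k hjk => by
      rcases lt_or_gt_of_ne hjk with hlt | hlt
      · exact horth j k hlt
      · rw [hcomm _ (hdB j) _ (hdB k)]; exact horth k j hlt)
  have hconst : ∀ k, N ≤ k → S x * f k = S x * f N := by
    intro k hk
    induction k, hk using Nat.le_induction with
    | base => rfl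
    | succ k hk ih =>
      have := hN k hk
      rw [mul_sub, sub_eq_zero] at this
      rw [← this, ih]
  have hcau : CauchySeq c := by
    refine cauchySeq_of_le_geometric (1 / 2) 1 (by norm_num) fun k => ?_
    rw [dist_comm, dist_eq_norm, one_mul]
    exact (hfc k).2
  obtain ⟨c0, hc0⟩ := cauchySeq_tendsto_of_complete hcau
  obtain ⟨P, hPB, hP, haP, hPk⟩ := aux_ker_proj B (x - c0 • 1)
    (sub_mem hx (SMulMemClass.smul_mem _ (one_mem B)))
  have hSP : S x * P = 0 := by
    rw [← h.proj _ hx _ hPB hP]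
    rw [sub_mul, smul_mul_assoc, one_mul, sub_eq_zero] at haP
    rw [haP, h.smul _ _ hPB, h.apply_proj hPB hP, smul_zero]
  have key : P * (f N * star (S x)) = f N * star (S x) := by
    ext ξ
    apply hPk
    set w := (f N * star (S x)) ξ with hw
    have hwk : ∀ k, N ≤ k → f k w = w := by
      intro k hk
      have h3 := congrArg star (hconst k hk)
      rw [star_mul, star_mul, (hf k).2.1.isSelfAdjoint.star_eq,
        (hf N).2.1.isSelfAdjoint.star_eq] at h3
      rw [hw, ← h3]
      change (f k * (f k * star (S x))) ξ = _
      rw [← mul_assoc, (hf k).2.1.isIdempotentElem.eq]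
    have hlim : Filter.Tendsto (fun k => c k • w) Filter.atTop (nhds (x w)) := by
      rw [tendsto_iff_norm_sub_tendsto_zero]
      have hg : Filter.Tendsto (fun k : ℕ => (1 / 2 : ℝ) ^ k * ‖w‖) Filter.atTop (nhds 0) := by
        simpa using (tendsto_pow_atTop_nhds_zero_of_lt_one (r := (1 / 2 : ℝ)) (by norm_num)
          (by norm_num)).mul_const ‖w‖
      refine squeeze_zero' (Filter.Eventually.of_forall fun _ => norm_nonneg _) ?_ hg
      filter_upwards [Filter.eventually_ge_atTop N] with k hk
      have h4 := DFunLike.congr_fun (hf k).2.2.2.2 w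
      change x (f k w) = c k • f k w + ((1 / 2 : ℂ) ^ k) • r k (f k w) at h4
      rw [hwk k hk] at h4
      rw [h4, sub_add_cancel_left, norm_neg, norm_smul, norm_pow]
      have e : ‖(1 / 2 : ℂ)‖ = 1 / 2 := by simp
      rw [e]
      have := (r k).le_of_opNorm_le (hf k).2.2.2.1 w
      rw [one_mul] at this
      gcongr
    have h5 := tendsto_nhds_unique hlim (hc0.smul_const w)
    change x w - c0 • w = 0
    rw [h5, sub_self]
  have h6 := congrArg star key
  rw [star_mul, star_mul, star_star, (hf N).2.1.isSelfAdjoint.star_eq,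
    hP.isSelfAdjoint.star_eq, mul_assoc, hcomm _ (hf N).1 _ hPB, ← mul_assoc, hSP, zero_mul] at h6
  exact (hf N).2.2.1 h6.symm

theorem AuxLoc.zero_sa {B : VonNeumannAlgebra H} {S : (H →L[ℂ] H) → (H →L[ℂ] H)}
    (h : AuxLoc B S) (hcomm : ∀ x ∈ B, ∀ y ∈ B, x * y = y * x)
    {x : H →L[ℂ] H} (hx : x ∈ B) (hsa : IsSelfAdjoint x) : S x = 0 := by
  have key : ∀ x ∈ B, IsSelfAdjoint x → ‖x‖ ≤ 1 → S x = 0 := by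
    intro x hx hsa hn
    have b1 : x ≤ 1 := by
      have := hsa.le_algebraMap_norm_self
      refine this.trans ?_
      rw [← map_one (algebraMap ℝ (H →L[ℂ] H))]
      exact algebraMap_mono _ hn
    have b2 : -1 ≤ x := by
      have := hsa.neg_algebraMap_norm_le_self
      refine le_trans ?_ this
      rw [← map_one (algebraMap ℝ (H →L[ℂ] H)), neg_le_neg_iff]
      exact algebraMap_mono _ hn
    have hB : (1 / 2 : ℂ) • (x + 1) ∈ B := SMulMemClass.smul_mem _ (add_mem hx (one_mem B))
    have hh : ∀ z : H →L[ℂ] H, 0 ≤ z → 0 ≤ (1 / 2 : ℂ) • z := fun z hz =>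
      smul_nonneg (by norm_num [Complex.le_def]) hz
    have h3 := h.zero_unit hcomm hB (hh _ (by
      have := sub_nonneg.2 b2
      simpa using this)) (by
      rw [← sub_nonneg]
      have e : 1 - (1 / 2 : ℂ) • (x + 1) = (1 / 2 : ℂ) • (1 - x) := by
        module
      rw [e]
      exact hh _ (sub_nonneg.2 b1))
    rw [h.smul _ _ (add_mem hx (one_mem B)), h.add _ hx _ (one_mem B), h.one, add_zero] at h3
    exact (smul_eq_zero.1 h3).resolve_left (by norm_num)
  by_cases hz : x = 0
  · subst hz
    exact key _ hx hsa (by simp)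
  · have hpos : 0 < ‖x‖ := norm_pos_iff.2 hz
    have h3 := key (((‖x‖⁻¹ : ℝ) : ℂ) • x) (SMulMemClass.smul_mem _ hx) (by
      rw [Complex.coe_smul]
      exact (IsSelfAdjoint.all _).smul hsa) (by
      rw [norm_smul, Complex.norm_real, norm_inv, norm_norm, inv_mul_cancel₀ hpos.ne'])
    rw [h.smul _ _ hx] at h3
    refine (smul_eq_zero.1 h3).resolve_left ?_
    simpa using hz

theorem AuxLoc.zero {B : VonNeumannAlgebra H} {S : (H →L[ℂ] H) → (H →L[ℂ] H)}
    (h : AuxLoc B S) (hcomm : ∀ x ∈ B, ∀ y ∈ B, x * y = y * x)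
    {x : H →L[ℂ] H} (hx : x ∈ B) : S x = 0 := by
  have hs : star x ∈ B := star_mem hx
  have e : x = (1 / 2 : ℂ) • (x + star x) + (-Complex.I / 2) • (Complex.I • (x - star x)) := by
    rw [smul_smul]
    have : -Complex.I / 2 * Complex.I = 1 / 2 := by
      rw [div_mul_eq_mul_div, neg_mul, Complex.I_mul_I]; norm_num
    rw [this]
    module
  have m1 : x + star x ∈ B := add_mem hx hs
  have m2 : Complex.I • (x - star x) ∈ B := SMulMemClass.smul_mem _ (sub_mem hx hs)
  rw [e, h.add _ (SMulMemClass.smul_mem _ m1) _ (SMulMemClass.smul_mem _ m2), h.smul _ _ m1,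
    h.smul _ _ m2, h.zero_sa hcomm m1 (IsSelfAdjoint.add_star_self x), h.zero_sa hcomm m2, smul_zero,
    smul_zero, add_zero]
  rw [IsSelfAdjoint, star_smul, star_sub, star_star]
  simp only [RCLike.star_def, Complex.conj_I]
  module

/-- Lemma on left-annihilator-preserving maps from a commutative von Neumann subalgebra `B`
of `M` into `M`: for a sequence of non-zero mutually orthogonal projections `pₙ` in `B`, the
map `a ↦ pₙ T a` is continuous for all but finitely many `n`. -/
theorem left_annihilator_preserving_proj_continuous (B M : VonNeumannAlgebra H)
    (hBM : ∀ x ∈ B, x ∈ M) (hcomm : ∀ x ∈ B, ∀ y ∈ B, x * y = y * x)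
    (T : ↥B → H →L[ℂ] H) (hlin : IsLinearMap ℂ T) (hTM : ∀ x : ↥B, T x ∈ M)
    (hann : ∀ (x : ↥B) (a : H →L[ℂ] H), a ∈ M → (x : H →L[ℂ] H) * a = 0 → T x * a = 0)
    (p : ℕ → ↥B) (hpz : ∀ n, p n ≠ 0) (hpsa : ∀ n, star (p n) = p n)
    (hpid : ∀ n, p n * p n = p n) (horth : ∀ n m, n ≠ m → p n * p m = 0) :
    {n : ℕ | ¬ Continuous fun x : ↥B => (p n : H →L[ℂ] H) * T x}.Finite := by
  have hmulT : ∀ (x q : ↥B), IsStarProjection (q : H →L[ℂ] H) → T (x * q) = T x * q := by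
    intro x q hq
    have hqq := hq.isIdempotentElem.eq
    have e1 : T (x * q) * (1 - (q : H →L[ℂ] H)) = 0 := by
      refine hann _ _ (sub_mem (one_mem M) (hBM _ q.2)) ?_
      change (x : H →L[ℂ] H) * q * (1 - (q : H →L[ℂ] H)) = 0
      rw [mul_assoc, hq.mul_one_sub_self, mul_zero]
    have e2 : T (x - x * q) * (q : H →L[ℂ] H) = 0 := by
      refine hann _ _ (hBM _ q.2) ?_
      change ((x : H →L[ℂ] H) - x * q) * (q : H →L[ℂ] H) = 0
      rw [sub_mul, mul_assoc, hqq, sub_self]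
    rw [hlin.map_sub, sub_mul, sub_eq_zero] at e2
    rw [mul_sub, mul_one, sub_eq_zero] at e1
    rw [e1, ← e2]
  classical
  have hloc : AuxLoc B (fun x => if hx : x ∈ B then T ⟨x, hx⟩ - T 1 * x else 0) := by
    refine ⟨?_, ?_, ?_, ?_⟩
    · intro x hx y hy
      have e : T ⟨x + y, add_mem hx hy⟩ = T ⟨x, hx⟩ + T ⟨y, hy⟩ := hlin.map_add ⟨x, hx⟩ ⟨y, hy⟩
      simp only [hx, hy, add_mem hx hy, dif_pos, e, mul_add]
      abel
    · intro c x hx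
      have hc : c • x ∈ B := SMulMemClass.smul_mem _ hx
      have e : T ⟨c • x, hc⟩ = c • T ⟨x, hx⟩ := hlin.map_smul c ⟨x, hx⟩
      simp only [hx, hc, dif_pos, e, mul_smul_comm, smul_sub]
    · intro x hx q hq hqp
      have e : T ⟨x * q, mul_mem hx hq⟩ = T ⟨x, hx⟩ * q := hmulT ⟨x, hx⟩ ⟨q, hq⟩ hqp
      simp only [hx, mul_mem hx hq, dif_pos, e, sub_mul, mul_assoc]
    · have e : T ⟨1, one_mem B⟩ = T 1 := rfl
      simp only [one_mem B, dif_pos, e, mul_one, sub_self]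
  have hT : ∀ x : ↥B, T x = T 1 * x := by
    intro x
    have := hloc.zero hcomm x.2
    simp only [x.2, dif_pos, sub_eq_zero] at this
    exact this
  convert Set.finite_empty
  rw [Set.eq_empty_iff_forall_notMem]
  intro n hn
  apply hn
  have : (fun x : ↥B => (p n : H →L[ℂ] H) * T x) = fun x : ↥B => (p n : H →L[ℂ] H) * (T 1 * x) := by
    funext x
    rw [hT x]
  rw [this]
  exact continuous_const.mul (continuous_const.mul continuous_subtype_val)
end

section
/- Let B be a commutative von Neumann subalgebra of a von Neumann algebra M containing the unit of M. Then every linear left-annihilator-preserving map T : B → M is continuous. -/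
open scoped ComplexOrder InnerProductSpace

variable {H : Type*} [NormedAddCommGroup H] [InnerProductSpace ℂ H] [CompleteSpace H]

namespace LeftAnn

theorem isClosed_vn (B : VonNeumannAlgebra H) : IsClosed (B : Set (H →L[ℂ] H)) := by
  rw [← B.centralizer_centralizer]
  exact Set.isClosed_centralizer _

/-- The kernel projection of an operator in `B` lies in `B`. -/
theorem exists_ker_proj (B : VonNeumannAlgebra H) (a b : H →L[ℂ] H)
    (ha : ∀ y ∈ B.commutant, Commute a y) (hb : IsSelfAdjoint b) (hab : a * b = 0) :
    ∃ p ∈ B, IsStarProjection p ∧ a * p = 0 ∧ b * p = b := by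
  have hcl : IsClosed ((LinearMap.ker (a : H →ₗ[ℂ] H) : Submodule ℂ H) : Set H) :=
    ContinuousLinearMap.isClosed_ker a
  set K : Submodule ℂ H := LinearMap.ker (a : H →ₗ[ℂ] H) with hK
  haveI : CompleteSpace K := hcl.completeSpace_coe
  have hp : IsStarProjection K.starProjection := isStarProjection_starProjection
  refine ⟨K.starProjection, ?_, hp, ?_, ?_⟩
  · rw [VonNeumannAlgebra.IsStarProjection.mem_iff hp]
    intro y hy
    rw [Module.End.mem_invtSubmodule]
    intro v hv
    have hr : K.starProjection.range = K := Submodule.range_starProjection K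
    rw [hr] at hv ⊢
    have h1 : a v = 0 := hv
    have h2 : a (y v) = y (a v) := congrArg (fun z : H →L[ℂ] H => z v) (ha y hy).eq
    change a (y v) = 0
    rw [h2, h1, map_zero]
  · ext v
    have : K.starProjection v ∈ K := Submodule.starProjection_apply_mem K v
    exact this
  · have h : K.starProjection * b = b := by
      ext v
      refine Submodule.starProjection_eq_self_iff.mpr ?_
      change a (b v) = 0
      exact congrArg (fun z : H →L[ℂ] H => z v) hab
    have h3 := congrArg star h
    rwa [star_mul, hb.star_eq, hp.isSelfAdjoint.star_eq] at h3

theorem exists_sign (B : VonNeumannAlgebra H) (x : H →L[ℂ] H) (hx : x ∈ B)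
    (hsa : IsSelfAdjoint x) (c : ℝ) (hc : ‖x‖ ≤ c) :
    ∃ p ∈ B, IsStarProjection p ∧ ‖x - ((c / 2 : ℝ) : ℂ) • (1 - (2 : ℂ) • p)‖ ≤ c / 2 := by
  have hc0 : 0 ≤ c := (norm_nonneg x).trans hc
  have hP : cfc (fun t : ℝ => max t 0) x * cfc (fun t : ℝ => max (-t) 0) x = 0 := by
    rw [← cfc_mul (fun t : ℝ => max t 0) (fun t : ℝ => max (-t) 0) x (by fun_prop) (by fun_prop)]
    rw [show (fun t : ℝ => max t 0 * max (-t) 0) = fun _ => 0 by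
      funext t
      rcases le_total t 0 with h | h
      · simp [h]
      · simp [h]]
    simp
  obtain ⟨p, hpB, hp, h1, h2⟩ := exists_ker_proj B (cfc (fun t : ℝ => max t 0) x)
    (cfc (fun t : ℝ => max (-t) 0) x) (fun y hy => by
      have : Commute x y := VonNeumannAlgebra.mem_commutant_iff.mp hy x hx
      exact this.cfc_real _) (cfc_predicate _ _) hP
  refine ⟨p, hpB, hp, ?_⟩
  have hxd : x = cfc (fun t : ℝ => max t 0) x - cfc (fun t : ℝ => max (-t) 0) x := by
    rw [← cfc_sub (fun t : ℝ => max t 0) (fun t : ℝ => max (-t) 0) x (by fun_prop) (by fun_prop)]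
    conv_lhs => rw [← cfc_id ℝ x]
    congr 1
    funext t
    rcases le_total t 0 with h | h
    · simp [h]
    · simp [h]
  have hab : cfc (fun t : ℝ => |t| - c / 2) x = cfc (fun t : ℝ => max t 0) x
      + cfc (fun t : ℝ => max (-t) 0) x - ((c / 2 : ℝ) : ℂ) • 1 := by
    have hcc : ((c / 2 : ℝ) : ℂ) • (1 : H →L[ℂ] H) = cfc (fun _ : ℝ => c / 2) x := by
      rw [cfc_const (c / 2) x]
      rw [Algebra.algebraMap_eq_smul_one]
      exact Complex.coe_smul (c / 2) (1 : H →L[ℂ] H)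
    rw [hcc, ← cfc_add (a := x) (fun t : ℝ => max t 0) (fun t : ℝ => max (-t) 0) (by fun_prop) (by fun_prop),
      ← cfc_sub (fun t : ℝ => max t 0 + max (-t) 0) (fun _ : ℝ => c / 2) x (by fun_prop)
        (by fun_prop)]
    congr 1
    funext t
    rcases le_total t 0 with h | h
    · simp [h, abs_of_nonpos]
    · simp [h, abs_of_nonneg]
  have hn : ‖cfc (fun t : ℝ => |t| - c / 2) x‖ ≤ c / 2 := by
    refine norm_cfc_le (by positivity) ?_
    intro t ht
    have h3 : ‖t‖ ≤ ‖x‖ := by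
      haveI : Nontrivial (H →L[ℂ] H) := by
        by_contra hcon
        rw [not_nontrivial_iff_subsingleton] at hcon
        rw [spectrum.of_subsingleton] at ht
        exact ht
      exact spectrum.norm_le_norm_of_mem ht
    rw [Real.norm_eq_abs] at h3 ⊢
    rw [abs_le]
    constructor <;> linarith [abs_nonneg t]
  set P := cfc (fun t : ℝ => max t 0) x
  set N := cfc (fun t : ℝ => max (-t) 0) x
  set A := cfc (fun t : ℝ => |t| - c / 2) x
  have hpp : p * p = p := hp.isIdempotentElem
  set u : H →L[ℂ] H := 1 - (2 : ℂ) • p with hu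
  have huu : u * u = 1 := by
    rw [hu]
    simp only [mul_sub, sub_mul, mul_one, one_mul, smul_mul_assoc, mul_smul_comm, hpp]
    module
  have hus : star u = u := by
    rw [hu]; simp [hp.isSelfAdjoint.star_eq]
  have hun : ‖u‖ ≤ 1 := by
    have h5 : ‖star u * u‖ = ‖u‖ * ‖u‖ := CStarRing.norm_star_mul_self
    rw [hus, huu] at h5
    have h6 : ‖(1 : H →L[ℂ] H)‖ ≤ 1 := ContinuousLinearMap.norm_id_le
    nlinarith [norm_nonneg u]
  have hAu : A * u = x - ((c / 2 : ℝ) : ℂ) • u := by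
    have hxu : x * u = P + N := by
      rw [hu]
      conv_lhs => rw [hxd]
      simp only [mul_sub, sub_mul, mul_one, mul_smul_comm, h1, h2]
      module
    rw [hab, ← hxu, sub_mul, mul_assoc, huu, mul_one, smul_mul_assoc, one_mul]
  rw [← hAu]
  calc ‖A * u‖ ≤ ‖A‖ * ‖u‖ := norm_mul_le _ _
    _ ≤ (c / 2) * 1 := by gcongr
    _ = c / 2 := mul_one _

/-- Finite linear combinations of projections in `B`. -/
def Simple (B : VonNeumannAlgebra H) : Submodule ℂ (H →L[ℂ] H) :=
  Submodule.span ℂ {p | p ∈ B ∧ IsStarProjection p}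

theorem simple_mem {B : VonNeumannAlgebra H} {s : H →L[ℂ] H} (hs : s ∈ Simple B) : s ∈ B := by
  induction hs using Submodule.span_induction with
  | mem x h => exact h.1
  | zero => exact zero_mem B
  | add x y _ _ hx hy => exact add_mem hx hy
  | smul a x _ hx => exact SMulMemClass.smul_mem a hx

theorem exists_simple_aux (B : VonNeumannAlgebra H) (x : H →L[ℂ] H) (hx : x ∈ B)
    (hsa : IsSelfAdjoint x) (n : ℕ) :
    ∃ s ∈ Simple B, IsSelfAdjoint s ∧ ‖x - s‖ ≤ ‖x‖ * (1 / 2) ^ n := by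
  induction n with
  | zero => exact ⟨0, zero_mem _, IsSelfAdjoint.zero _, by simp⟩
  | succ n ih =>
    obtain ⟨s, hs, hss, hn⟩ := ih
    obtain ⟨p, hpB, hp, hle⟩ := exists_sign B (x - s) (sub_mem hx (simple_mem hs))
      (hsa.sub hss) _ hn
    refine ⟨s + ((‖x‖ * (1 / 2) ^ n / 2 : ℝ) : ℂ) • (1 - (2 : ℂ) • p), ?_, ?_, ?_⟩
    · refine add_mem hs (Submodule.smul_mem _ _ (sub_mem ?_ (Submodule.smul_mem _ _ ?_)))
      · exact Submodule.subset_span ⟨one_mem B, IsStarProjection.one _⟩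
      · exact Submodule.subset_span ⟨hpB, hp⟩
    · rw [IsSelfAdjoint, star_add, star_smul, star_sub, star_smul, hss.star_eq,
        hp.isSelfAdjoint.star_eq]
      simp
    · rw [← sub_sub]
      refine hle.trans (le_of_eq ?_)
      rw [pow_succ]; ring

theorem exists_simple (B : VonNeumannAlgebra H) (x : H →L[ℂ] H) (hx : x ∈ B)
    (hsa : IsSelfAdjoint x) (ε : ℝ) (hε : 0 < ε) :
    ∃ s ∈ Simple B, ‖x - s‖ ≤ ε := by
  have ht : Filter.Tendsto (fun n : ℕ => ‖x‖ * (1 / 2 : ℝ) ^ n) Filter.atTop (nhds (‖x‖ * 0)) :=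
    (tendsto_pow_atTop_nhds_zero_of_lt_one (by norm_num) (by norm_num)).const_mul _
  rw [mul_zero] at ht
  obtain ⟨n, hn⟩ := (ht.eventually (gt_mem_nhds hε)).exists
  obtain ⟨s, hs, -, h⟩ := exists_simple_aux B x hx hsa n
  exact ⟨s, hs, h.trans hn.le⟩

theorem exists_split (B : VonNeumannAlgebra H) (hcomm : ∀ x ∈ B, ∀ y ∈ B, x * y = y * x)
    (x d : H →L[ℂ] H) (hx : x ∈ B) (hsa : IsSelfAdjoint x)
    (hd : ∀ e ∈ B, IsStarProjection e → ∀ μ : ℂ, d * e * x = μ • (d * e) → d * e = 0)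
    (e : H →L[ℂ] H) (heB : e ∈ B) (he : IsStarProjection e) (hde : d * e ≠ 0) :
    ∃ f ∈ B, IsStarProjection f ∧ e * f = f ∧ d * f ≠ 0 ∧ d * (e - f) ≠ 0 := by
  by_contra hcon
  push Not at hcon
  have hsimple : ∀ s ∈ Simple B, ∃ μ : ℂ, d * e * s = μ • (d * e) := by
    intro s hs
    induction hs using Submodule.span_induction with
    | mem p h =>
      obtain ⟨hpB, hp⟩ := h
      have hep : IsStarProjection (e * p) := he.mul hp (hcomm e heB p hpB)
      by_cases h0 : d * (e * p) = 0
      · exact ⟨0, by rw [mul_assoc, h0, zero_smul]⟩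
      · have := hcon (e * p) (mul_mem heB hpB) hep
          (by rw [← mul_assoc, he.isIdempotentElem.eq]) h0
        rw [mul_sub, sub_eq_zero] at this
        exact ⟨1, by rw [mul_assoc, ← this, one_smul]⟩
    | zero => exact ⟨0, by simp⟩
    | add a b _ _ ha hb =>
      obtain ⟨μ, h1⟩ := ha
      obtain ⟨ν, h2⟩ := hb
      exact ⟨μ + ν, by rw [mul_add, h1, h2, add_smul]⟩
    | smul a b _ hb =>
      obtain ⟨μ, h1⟩ := hb
      exact ⟨a * μ, by rw [mul_smul_comm, h1, mul_smul]⟩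
  have hmem : d * e * x ∈ Submodule.span ℂ {d * e} := by
    have hcl : IsClosed ((Submodule.span ℂ {d * e} : Submodule ℂ (H →L[ℂ] H)) :
      Set (H →L[ℂ] H)) := Submodule.closed_of_finiteDimensional _
    rw [← SetLike.mem_coe, ← hcl.closure_eq, Metric.mem_closure_iff]
    intro ε hε
    obtain ⟨s, hs, hle⟩ := exists_simple B x hx hsa (ε / (‖d * e‖ + 1)) (by positivity)
    obtain ⟨μ, hμ⟩ := hsimple s hs
    refine ⟨d * e * s, ?_, ?_⟩
    · rw [hμ]; exact Submodule.smul_mem _ _ (Submodule.mem_span_singleton_self _)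
    · rw [dist_eq_norm, ← mul_sub]
      calc ‖d * e * (x - s)‖ ≤ ‖d * e‖ * ‖x - s‖ := norm_mul_le _ _
        _ ≤ ‖d * e‖ * (ε / (‖d * e‖ + 1)) := by gcongr
        _ < (‖d * e‖ + 1) * (ε / (‖d * e‖ + 1)) := by
          have : 0 < ε / (‖d * e‖ + 1) := by positivity
          nlinarith
        _ = ε := by field_simp
  obtain ⟨μ, hμ⟩ := Submodule.mem_span_singleton.mp hmem
  exact hde (hd e heB he μ hμ.symm)

theorem exists_seq (B : VonNeumannAlgebra H) (hcomm : ∀ x ∈ B, ∀ y ∈ B, x * y = y * x)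
    (x d : H →L[ℂ] H) (hx : x ∈ B) (hsa : IsSelfAdjoint x)
    (hd : ∀ e ∈ B, IsStarProjection e → ∀ μ : ℂ, d * e * x = μ • (d * e) → d * e = 0)
    (hd0 : d ≠ 0) :
    ∃ q : ℕ → H →L[ℂ] H, (∀ n, q n ∈ B) ∧ (∀ n, IsStarProjection (q n)) ∧
      (∀ n, d * q n ≠ 0) ∧ ∀ m n, m ≠ n → q m * q n = 0 := by
  have hstep := exists_split B hcomm x d hx hsa hd
  let S := {e : H →L[ℂ] H // e ∈ B ∧ IsStarProjection e ∧ d * e ≠ 0}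
  have hs : ∀ e : S, ∃ f : S, e.1 * f.1 = f.1 ∧ d * (e.1 - f.1) ≠ 0 := by
    rintro ⟨e, h1, h2, h3⟩
    obtain ⟨f, g1, g2, g3, g4, g5⟩ := hstep e h1 h2 h3
    exact ⟨⟨f, g1, g2, g4⟩, g3, g5⟩
  choose F hF1 hF2 using hs
  let e : ℕ → S := fun n => F^[n] ⟨1, one_mem B, IsStarProjection.one _, by simpa using hd0⟩
  have hes : ∀ n, e (n + 1) = F (e n) := fun n => Function.iterate_succ_apply' F n _
  have hmul : ∀ n k, (e n).1 * (e (n + k)).1 = (e (n + k)).1 := by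
    intro n k
    induction k with
    | zero => exact (e n).2.2.1.isIdempotentElem
    | succ k ih =>
      have h := hF1 (e (n + k))
      rw [← hes] at h
      rw [← add_assoc, ← h, ← mul_assoc, ih]
  have hmul' : ∀ m n, m ≤ n → (e m).1 * (e n).1 = (e n).1 := by
    intro m n h
    obtain ⟨k, rfl⟩ := Nat.exists_eq_add_of_le h
    exact hmul m k
  have hmul2 : ∀ m n, m ≤ n → (e n).1 * (e m).1 = (e n).1 := by
    intro m n h
    rw [hcomm _ (e n).2.1 _ (e m).2.1, hmul' m n h]
  have hid : ∀ n, (e n).1 * (e n).1 = (e n).1 := fun n => hmul' n n le_rfl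
  have hlt : ∀ m n, m < n → ((e m).1 - (e (m + 1)).1) * ((e n).1 - (e (n + 1)).1) = 0 := by
    intro m n h
    simp only [mul_sub, sub_mul]
    rw [hmul' m n h.le, hmul' (m + 1) n h, hmul' m (n + 1) (by lia),
      hmul' (m + 1) (n + 1) (by lia)]
    simp
  refine ⟨fun n => (e n).1 - (e (n + 1)).1, ?_, ?_, ?_, ?_⟩
  · exact fun n => sub_mem (e n).2.1 (e (n + 1)).2.1
  · intro n
    constructor
    · change ((e n).1 - (e (n + 1)).1) * ((e n).1 - (e (n + 1)).1) = (e n).1 - (e (n + 1)).1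
      simp only [mul_sub, sub_mul]
      rw [hid, hid, hmul' n (n + 1) (by lia), hmul2 n (n + 1) (by lia)]
      simp
    · exact (e n).2.2.1.isSelfAdjoint.sub (e (n + 1)).2.2.1.isSelfAdjoint
  · intro n
    have := hF2 (e n)
    rwa [← hes] at this
  · intro m n hmn
    rcases lt_or_gt_of_ne hmn with h | h
    · exact hlt m n h
    · have h1 := hlt n m h
      rw [hcomm _ (sub_mem (e n).2.1 (e (n + 1)).2.1) _ (sub_mem (e m).2.1 (e (m + 1)).2.1)] at h1
      exact h1

theorem D_zero (B M : VonNeumannAlgebra H)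
    (hBM : ∀ x ∈ B, x ∈ M) (hcomm : ∀ x ∈ B, ∀ y ∈ B, x * y = y * x)
    (D : ↥B →ₗ[ℂ] (H →L[ℂ] H)) (hDM : ∀ x : ↥B, D x ∈ M)
    (hann : ∀ (x : ↥B) (a : H →L[ℂ] H), a ∈ M → (x : H →L[ℂ] H) * a = 0 → D x * a = 0)
    (hD1 : D 1 = 0) (x : ↥B) (hsa : IsSelfAdjoint (x : H →L[ℂ] H)) : D x = 0 := by
  -- locality
  have hloc : ∀ (y p : ↥B), IsStarProjection (p : H →L[ℂ] H) → D (y * p) = D y * p := by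
    intro y p hp
    have hpp : (p : H →L[ℂ] H) * p = p := hp.isIdempotentElem
    have h1 : D (y * p) * (1 - (p : H →L[ℂ] H)) = 0 := by
      refine hann _ _ (hBM _ (sub_mem (one_mem B) p.2)) ?_
      change (y : H →L[ℂ] H) * p * (1 - p) = 0
      rw [mul_assoc, mul_sub, mul_one, hpp, sub_self, mul_zero]
    have h2 : D (y - y * p) * (p : H →L[ℂ] H) = 0 := by
      refine hann _ _ (hBM _ p.2) ?_
      change ((y : H →L[ℂ] H) - y * p) * p = 0
      rw [sub_mul, mul_assoc, hpp, sub_self]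
    rw [mul_sub, mul_one, sub_eq_zero] at h1
    rw [map_sub, sub_mul, sub_eq_zero] at h2
    rw [h1, h2]
  have hDs : ∀ s (hs : s ∈ Simple B), D ⟨s, simple_mem hs⟩ = 0 := by
    intro s hs
    induction hs using Submodule.span_induction with
    | mem p h =>
      have := hloc 1 ⟨p, h.1⟩ h.2
      rw [hD1, zero_mul, one_mul] at this
      exact this
    | zero => exact map_zero D
    | add a b ha hb h1 h2 =>
      have := map_add D ⟨a, simple_mem ha⟩ ⟨b, simple_mem hb⟩
      rw [h1, h2, add_zero] at this
      exact this
    | smul c a ha h1 =>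
      have := map_smul D c ⟨a, simple_mem ha⟩
      rw [h1, smul_zero] at this
      exact this
  by_contra hne
  obtain ⟨q, hqB, hq, hdq, hqq⟩ := exists_seq B hcomm x (D x) x.2 hsa (by
    intro e heB he μ hμ
    have hee : e * e = e := he.isIdempotentElem
    have hes : star e = e := he.isSelfAdjoint
    have h1 := congrArg star hμ
    rw [star_mul, star_smul, hsa.star_eq] at h1
    have h2 := hann (x - (star μ) • (1 : ↥B)) (star (D x * e))
      (star_mem (mul_mem (hDM x) (hBM e heB))) (by
        change ((x : H →L[ℂ] H) - star μ • (1 : H →L[ℂ] H)) * _ = 0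
        rw [sub_mul, h1, smul_mul_assoc, one_mul, sub_self])
    rw [map_sub, map_smul, hD1, smul_zero, sub_zero, star_mul, hes] at h2
    have h3 : (D x * e) * star (D x * e) = 0 := by
      rw [star_mul, hes, mul_assoc, ← mul_assoc e e, hee, h2]
    exact (CStarRing.mul_star_self_eq_zero_iff _).mp h3) hne
  have hpos : ∀ n, 0 < ‖D x * q n‖ := fun n => norm_pos_iff.mpr (hdq n)
  let c : ℕ → ℝ := fun n => ((n : ℝ) + 1) / ‖D x * q n‖
  have hc : ∀ n, 0 < c n := fun n => by have := hpos n; positivity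
  have hs := fun n => exists_simple B x x.2 hsa ((1 / 2) ^ n / c n) (by have := hc n; positivity)
  choose s hsS hsn using hs
  have hqn : ∀ n, ‖q n‖ ≤ 1 := fun n => (hq n).norm_le
  let a : ℕ → H →L[ℂ] H := fun n => (c n : ℂ) • ((x - s n) * q n)
  have haB : ∀ n, a n ∈ B := fun n =>
    SMulMemClass.smul_mem _ (mul_mem (sub_mem x.2 (simple_mem (hsS n))) (hqB n))
  have hasum : Summable a := by
    refine Summable.of_norm_bounded (g := fun n => (1 / 2 : ℝ) ^ n)
      (summable_geometric_of_lt_one (by norm_num) (by norm_num)) ?_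
    intro n
    have h1 := hc n
    calc ‖a n‖ = c n * ‖(x - s n) * q n‖ := by
          rw [norm_smul, Complex.norm_real, Real.norm_eq_abs, abs_of_pos h1]
      _ ≤ c n * (‖(x : H →L[ℂ] H) - s n‖ * ‖q n‖) := by gcongr; exact norm_mul_le _ _
      _ ≤ c n * ((1 / 2) ^ n / c n * 1) := by gcongr; exacts [hsn n, hqn n]
      _ = (1 / 2) ^ n := by field_simp
  have hyB : (∑' n, a n) ∈ B := by
    have h := hasum.hasSum
    exact (isClosed_vn B).mem_of_tendsto h
      (Filter.Eventually.of_forall fun t => sum_mem fun i _ => haB i)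
  let y : ↥B := ⟨∑' n, a n, hyB⟩
  have hyq : ∀ n, (y : H →L[ℂ] H) * q n = a n := by
    intro n
    change (∑' n, a n) * q n = a n
    rw [← hasum.tsum_mul_right, tsum_eq_single n]
    · change (c n : ℂ) • ((x - s n) * q n) * q n = (c n : ℂ) • ((x - s n) * q n)
      rw [smul_mul_assoc, mul_assoc, (hq n).isIdempotentElem.eq]
    · intro m hm
      change (c m : ℂ) • ((x - s m) * q m) * q n = 0
      rw [smul_mul_assoc, mul_assoc, hqq m n hm, mul_zero, smul_zero]
  have hkey : ∀ n, D y * q n = (c n : ℂ) • (D x * q n) := by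
    intro n
    have h1 := hloc y ⟨q n, hqB n⟩ (hq n)
    have h2 : y * ⟨q n, hqB n⟩ = (c n : ℂ) • ((x - ⟨s n, simple_mem (hsS n)⟩) * ⟨q n, hqB n⟩) :=
      Subtype.ext (hyq n)
    rw [h2, map_smul, hloc _ _ (hq n), map_sub, hDs (s n) (hsS n), sub_zero] at h1
    exact h1.symm
  obtain ⟨n, hn⟩ := exists_nat_gt ‖D y‖
  have h1 : ‖D y * q n‖ = n + 1 := by
    rw [hkey, norm_smul, Complex.norm_real, Real.norm_eq_abs, abs_of_pos (hc n)]
    have := hpos n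
    change ((n : ℝ) + 1) / ‖D x * q n‖ * ‖D x * q n‖ = _
    field_simp
  have h2 : ‖D y * q n‖ ≤ ‖D y‖ * ‖q n‖ := norm_mul_le _ _
  have h3 := hqn n
  nlinarith [norm_nonneg (D y)]

end LeftAnn

/-- Every linear left-annihilator-preserving map from a unital commutative von Neumann
subalgebra `B` of `M` into `M` is continuous. -/
theorem left_annihilator_preserving_continuous (B M : VonNeumannAlgebra H)
    (hBM : ∀ x ∈ B, x ∈ M) (hcomm : ∀ x ∈ B, ∀ y ∈ B, x * y = y * x)
    (T : ↥B → H →L[ℂ] H) (hlin : IsLinearMap ℂ T) (hTM : ∀ x : ↥B, T x ∈ M)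
    (hann : ∀ (x : ↥B) (a : H →L[ℂ] H), a ∈ M → (x : H →L[ℂ] H) * a = 0 → T x * a = 0) :
    Continuous T := by
  let ι : ↥B →ₗ[ℂ] (H →L[ℂ] H) :=
    { toFun := Subtype.val, map_add' := fun _ _ => rfl, map_smul' := fun _ _ => rfl }
  let D : ↥B →ₗ[ℂ] (H →L[ℂ] H) := hlin.mk' T - (LinearMap.mulLeft ℂ (T 1)).comp ι
  have hD : ∀ x, D x = T x - T 1 * (x : H →L[ℂ] H) := fun x => rfl
  have hD0 := LeftAnn.D_zero B M hBM hcomm D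
    (fun x => by rw [hD]; exact sub_mem (hTM x) (mul_mem (hTM 1) (hBM _ x.2)))
    (fun x a ha h => by rw [hD, sub_mul, hann x a ha h, mul_assoc, h, mul_zero, sub_zero])
    (by rw [hD]; change T 1 - T 1 * 1 = 0; rw [mul_one, sub_self])
  have hall : ∀ x, D x = 0 := by
    intro x
    let xs : ↥B := ⟨star (x : H →L[ℂ] H), star_mem x.2⟩
    have h1 := hD0 (x + xs) (IsSelfAdjoint.add_star_self (x : H →L[ℂ] H))
    have h2 := hD0 (Complex.I • (x - xs)) (by
      change star (Complex.I • ((x : H →L[ℂ] H) - star (x : H →L[ℂ] H))) =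
        Complex.I • ((x : H →L[ℂ] H) - star (x : H →L[ℂ] H))
      rw [star_smul, star_sub, star_star, Complex.star_def, Complex.conj_I, neg_smul, ← smul_neg,
        neg_sub])
    rw [map_smul, smul_eq_zero_iff_right Complex.I_ne_zero, map_sub, sub_eq_zero] at h2
    rw [map_add, ← h2, ← two_smul ℂ, smul_eq_zero_iff_right two_ne_zero] at h1
    exact h1
  have hT : T = fun x : ↥B => T 1 * (x : H →L[ℂ] H) := by
    funext x
    exact sub_eq_zero.mp (hall x)
  rw [hT]
  exact continuous_const.mul continuous_subtype_val
end

section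
/- Every linear left-annihilator-preserving map T : M → M on a von Neumann algebra M is continuous and is a left multiplier, i.e. T(ab) = T(a)b for all a,b ∈ M. -/
open scoped ComplexOrder InnerProductSpace

variable {H : Type*} [NormedAddCommGroup H] [InnerProductSpace ℂ H] [CompleteSpace H]

section AnnAux

open Filter Topology

theorem annAux_norm_proj {A : Type*} [NormedRing A] [StarRing A] [CStarRing A] {p : A}
    (hp : IsStarProjection p) : ‖p‖ ≤ 1 := by
  have h : ‖p‖ = ‖p‖ * ‖p‖ := by
    have := CStarRing.norm_star_mul_self (x := p)
    rwa [hp.isSelfAdjoint.star_eq, hp.isIdempotentElem.eq] at this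
  by_contra hc
  push Not at hc
  nlinarith

/-- Gliding hump. -/
theorem annAux_hump {A : Type*} [NormedRing A] [StarRing A] [CStarRing A] [NormedAlgebra ℂ A]
    [CompleteSpace A] (S : A →ₗ[ℂ] A)
    (hS : ∀ a p : A, IsStarProjection p → S (a * p) = S a * p) (s : A) (r : ℕ → A)
    (hr : ∀ n, ‖r n‖ ≤ 1) (hSr : ∀ n, S (r n) = (2 : ℂ) ^ n • s) (q : ℕ → A)
    (hq : ∀ n, IsStarProjection (q n)) (hqq : ∀ m n, m ≠ n → q m * q n = 0)
    (hne : ∀ n, s * q n ≠ 0) : False := by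
  have hm : ∀ n : ℕ, ∃ m : ℕ, (n : ℝ) ≤ (1 / 2) ^ n * (2 ^ m * ‖s * q n‖) := by
    intro n
    have hpos : 0 < ‖s * q n‖ := norm_pos_iff.mpr (hne n)
    obtain ⟨m, hm⟩ := pow_unbounded_of_one_lt ((n : ℝ) / ((1 / 2) ^ n * ‖s * q n‖)) (one_lt_two)
    refine ⟨m, ?_⟩
    rw [div_lt_iff₀ (by positivity)] at hm
    nlinarith
  choose m hm using hm
  set f : ℕ → A := fun n => ((1 / 2 : ℂ) ^ n) • (r (m n) * q n) with hf
  have hb : ∀ n, ‖f n‖ ≤ (1 / 2 : ℝ) ^ n := by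
    intro n
    have h1 : ‖r (m n) * q n‖ ≤ 1 := (norm_mul_le _ _).trans
      (mul_le_one₀ (hr _) (norm_nonneg _) (annAux_norm_proj (hq n)))
    rw [hf]
    simp only [norm_smul, norm_pow]
    have h2 : ‖(1 / 2 : ℂ)‖ = 1 / 2 := by simp
    rw [h2]
    exact mul_le_of_le_one_right (by positivity) h1
  have hsum : Summable f :=
    Summable.of_norm_bounded (summable_geometric_of_lt_one (by norm_num) (by norm_num)) hb
  have hx : ∀ n, (∑' k, f k) * q n = f n := by
    intro n
    rw [← hsum.tsum_mul_right, tsum_eq_single n]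
    · simp [hf, mul_assoc, (hq n).isIdempotentElem.eq]
    · intro k hk
      simp [hf, mul_assoc, hqq k n hk]
  have hN : ∀ n : ℕ, (n : ℝ) ≤ ‖S (∑' k, f k)‖ := by
    intro n
    have h1 : S (∑' k, f k) * q n = ((1 / 2 : ℂ) ^ n) • ((2 : ℂ) ^ (m n) • (s * q n)) := by
      rw [← hS _ _ (hq n), hx n, hf]
      simp only [map_smul]
      rw [hS _ _ (hq n), hSr, smul_mul_assoc]
    have h2 : ‖S (∑' k, f k) * q n‖ ≤ ‖S (∑' k, f k)‖ := (norm_mul_le _ _).trans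
      (mul_le_of_le_one_right (norm_nonneg _) (annAux_norm_proj (hq n)))
    rw [h1] at h2
    simp only [norm_smul, norm_pow] at h2
    have h3 : ‖(1 / 2 : ℂ)‖ = 1 / 2 := by simp
    have h4 : ‖(2 : ℂ)‖ = 2 := by simp
    rw [h3, h4] at h2
    exact (hm n).trans h2
  obtain ⟨n, hn⟩ := exists_nat_gt ‖S (∑' k, f k)‖
  exact absurd (hN n) (not_le.mpr hn)

/-- One dyadic step. -/
theorem annAux_step {A : Type*} [NormedRing A] [StarRing A] [NormedAlgebra ℂ A]
    [StarModule ℂ A]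
    (H2 : ∀ c : A, IsSelfAdjoint c → ‖c‖ ≤ 1 → ∃ p, IsStarProjection p ∧
      (∀ b, IsSelfAdjoint b → Commute c b → Commute p b) ∧ ‖(2 : ℂ) • c - ((2 : ℂ) • p - 1)‖ ≤ 1)
    (S : A →ₗ[ℂ] A)
    (hS0 : ∀ p : A, IsStarProjection p → S p = 0) (r Q : A)
    (hr : IsSelfAdjoint r) (hr1 : ‖r‖ ≤ 1) (hQ : IsStarProjection Q) (hc : Commute r Q)
    (hne : S r * Q ≠ 0) :
    ∃ r' Q' : A, IsSelfAdjoint r' ∧ ‖r'‖ ≤ 1 ∧ IsStarProjection Q' ∧ Commute r' Q' ∧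
      S r' * Q' ≠ 0 ∧ S r' = (2 : ℂ) • S r ∧ Q * Q' = Q' ∧
      ∃ b : ℝ, r' * Q' = (2 : ℂ) • (r * Q') - (b : ℂ) • Q' := by
  obtain ⟨p, hp, hpc, hpn⟩ := H2 r hr hr1
  have hpQ : Commute p Q := hpc Q hQ.isSelfAdjoint hc
  have hpr : Commute p r := hpc r hr (Commute.refl r)
  have hS1 : S 1 = 0 := hS0 1 ⟨by simp [IsIdempotentElem], by simp [IsSelfAdjoint]⟩
  have hSr' : S ((2 : ℂ) • r - ((2 : ℂ) • p - 1)) = (2 : ℂ) • S r := by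
    simp [hS0 p hp, hS1]
  have h2 : IsSelfAdjoint (2 : ℂ) := by simp [IsSelfAdjoint]
  have hsa : IsSelfAdjoint ((2 : ℂ) • r - ((2 : ℂ) • p - 1)) :=
    (h2.smul hr).sub ((h2.smul hp.isSelfAdjoint).sub (IsSelfAdjoint.one A))
  have hp1 : IsStarProjection (1 - p) := hp.one_sub
  have key : ∀ (e : A) (b : ℝ), IsStarProjection e → Commute e Q → Commute e r → Commute e p →
      ((2 : ℂ) • p - 1) * e = (b : ℂ) • e → S r * (e * Q) ≠ 0 → 
      ∃ r' Q' : A, IsSelfAdjoint r' ∧ ‖r'‖ ≤ 1 ∧ IsStarProjection Q' ∧ Commute r' Q' ∧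
      S r' * Q' ≠ 0 ∧ S r' = (2 : ℂ) • S r ∧ Q * Q' = Q' ∧
      ∃ b : ℝ, r' * Q' = (2 : ℂ) • (r * Q') - (b : ℂ) • Q' := by
    intro e b he heQ her hep hb hne'
    refine ⟨(2 : ℂ) • r - ((2 : ℂ) • p - 1), e * Q, hsa, hpn, ?_, ?_, ?_, hSr', ?_, b, ?_⟩
    · refine ⟨?_, ?_⟩
      · exact IsIdempotentElem.mul_of_commute heQ he.isIdempotentElem hQ.isIdempotentElem
      · exact (IsSelfAdjoint.commute_iff he.isSelfAdjoint hQ.isSelfAdjoint).mp heQ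
    · have a1 : Commute r (e * Q) := her.symm.mul_right hc
      have a2 : Commute p (e * Q) := hep.symm.mul_right hpQ
      exact (a1.smul_left _).sub_left ((a2.smul_left _).sub_left (Commute.one_left _))
    · rw [hSr', smul_mul_assoc]
      exact smul_ne_zero two_ne_zero hne'
    · rw [heQ.eq, ← mul_assoc, hQ.isIdempotentElem.eq]
    · rw [sub_mul, smul_mul_assoc, ← mul_assoc ((2 : ℂ) • p - 1), hb, smul_mul_assoc]
  by_cases h : S r * (p * Q) = 0
  · refine key (1 - p) (-1) hp1 ((Commute.one_left _).sub_left hpQ)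
      ((Commute.one_left _).sub_left hpr) ((Commute.one_left _).sub_left (Commute.refl p)) ?_ ?_
    · simp [mul_sub, sub_mul, hp.isIdempotentElem.eq]
    · intro h'
      apply hne
      have : S r * Q = S r * (p * Q) + S r * ((1 - p) * Q) := by noncomm_ring
      rw [this, h, h', add_zero]
  · refine key p 1 hp hpQ hpr (Commute.refl p) ?_ h
    simp [sub_mul, add_mul, hp.isIdempotentElem.eq, two_smul]

theorem annAux_zero {A : Type*} [NormedRing A] [StarRing A] [CStarRing A] [NormedAlgebra ℂ A]
    [StarModule ℂ A] [CompleteSpace A]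
    (H1 : ∀ a : A, IsSelfAdjoint a → ∃ k, IsStarProjection k ∧ a * k = 0 ∧
      ∀ y, a * y = 0 → k * y = y)
    (H2 : ∀ c : A, IsSelfAdjoint c → ‖c‖ ≤ 1 → ∃ p, IsStarProjection p ∧
      (∀ b, IsSelfAdjoint b → Commute c b → Commute p b) ∧ ‖(2 : ℂ) • c - ((2 : ℂ) • p - 1)‖ ≤ 1)
    (S : A →ₗ[ℂ] A)
    (hS : ∀ a p : A, IsStarProjection p → S (a * p) = S a * p)
    (hS0 : ∀ p : A, IsStarProjection p → S p = 0) (x : A) (hx : IsSelfAdjoint x)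
    (hx1 : ‖x‖ ≤ 1) : S x = 0 := by
  by_contra hs
  let P : A × A → Prop := fun z => IsSelfAdjoint z.1 ∧ ‖z.1‖ ≤ 1 ∧ IsStarProjection z.2 ∧
    Commute z.1 z.2 ∧ S z.1 * z.2 ≠ 0
  have hstep : ∀ z : {z // P z}, ∃ z' : {z // P z}, S z'.1.1 = (2 : ℂ) • S z.1.1 ∧
      z.1.2 * z'.1.2 = z'.1.2 ∧
      ∃ b : ℝ, z'.1.1 * z'.1.2 = (2 : ℂ) • (z.1.1 * z'.1.2) - (b : ℂ) • z'.1.2 := by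
    rintro ⟨⟨r, Q⟩, h1, h2, h3, h4, h5⟩
    obtain ⟨r', Q', g1, g2, g3, g4, g5, g6, g7, g8⟩ :=
      annAux_step H2 S hS0 r Q h1 h2 h3 h4 h5
    exact ⟨⟨(r', Q'), g1, g2, g3, g4, g5⟩, g6, g7, g8⟩
  choose F hF1 hF2 hF3 using hstep
  have hone : IsStarProjection (1 : A) := ⟨by simp [IsIdempotentElem], by simp [IsSelfAdjoint]⟩
  let z : ℕ → {z // P z} := fun n => Nat.rec
    ⟨(x, 1), hx, hx1, hone, Commute.one_right x, by simpa using hs⟩ (fun _ w => F w) n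
  have hz : ∀ n, z (n + 1) = F (z n) := fun n => rfl
  set r : ℕ → A := fun n => (z n).1.1 with hrdef
  set Q : ℕ → A := fun n => (z n).1.2 with hQdef
  have hr0 : r 0 = x := rfl
  have hQ0 : Q 0 = 1 := rfl
  have hrsa : ∀ n, IsSelfAdjoint (r n) := fun n => (z n).2.1
  have hr1 : ∀ n, ‖r n‖ ≤ 1 := fun n => (z n).2.2.1
  have hQ : ∀ n, IsStarProjection (Q n) := fun n => (z n).2.2.2.1
  have hrQ : ∀ n, Commute (r n) (Q n) := fun n => (z n).2.2.2.2.1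
  have hne : ∀ n, S (r n) * Q n ≠ 0 := fun n => (z n).2.2.2.2.2
  have hSs : ∀ n, S (r (n + 1)) = (2 : ℂ) • S (r n) := fun n => hF1 (z n)
  have hQs : ∀ n, Q n * Q (n + 1) = Q (n + 1) := fun n => hF2 (z n)
  have hb : ∀ n, ∃ b : ℝ, r (n + 1) * Q (n + 1) = (2 : ℂ) • (r n * Q (n + 1)) -
    (b : ℂ) • Q (n + 1) := fun n => hF3 (z n)
  clear_value r Q
  clear hrdef hQdef hz z hF1 hF2 hF3 F
  have hSr : ∀ n, S (r n) = (2 : ℂ) ^ n • S x := by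
    intro n
    induction n with
    | zero => simp [hr0]
    | succ n ih => rw [hSs, ih, smul_smul, pow_succ']
  set s := S x with hsdef
  have hsQ : ∀ n, s * Q n ≠ 0 := by
    intro n h
    apply hne n
    rw [hSr, smul_mul_assoc, h, smul_zero]
  -- monotonicity of Q
  have hQmn : ∀ m n, m ≤ n → Q m * Q n = Q n := by
    intro m n h
    induction n, h using Nat.le_induction with
    | base => exact (hQ m).isIdempotentElem.eq
    | succ n _ ih => rw [← hQs n, ← mul_assoc, ih]
  have hQnm : ∀ m n, m ≤ n → Q n * Q m = Q n := by
    intro m n h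
    have := congrArg star (hQmn m n h)
    rwa [star_mul, (hQ m).isSelfAdjoint.star_eq, (hQ n).isSelfAdjoint.star_eq] at this
  -- x on Q n
  have hxQ : ∀ n, ∃ l : ℝ, x * Q n = (l : ℂ) • Q n + ((1 / 2 : ℂ) ^ n) • (r n * Q n) := by
    intro n
    induction n with
    | zero => exact ⟨0, by simp [hr0]⟩
    | succ n ih =>
      obtain ⟨l, hl⟩ := ih
      obtain ⟨b, hb⟩ := hb n
      refine ⟨l + (1 / 2) ^ (n + 1) * b, ?_⟩
      have h1 : x * Q (n + 1) = (l : ℂ) • Q (n + 1) + ((1 / 2 : ℂ) ^ n) • (r n * Q (n + 1)) := by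
        have := congrArg (· * Q (n + 1)) hl
        simpa [add_mul, mul_assoc, hQs n] using this
      rw [h1, hb, smul_sub, smul_smul, smul_smul]
      push_cast
      rw [add_smul, pow_succ]
      have : (1 / 2 : ℂ) ^ n * (1 / 2) * 2 = (1 / 2 : ℂ) ^ n := by ring
      rw [this]
      abel
  have hxcomm : ∀ n, Commute x (Q n) := by
    intro n
    obtain ⟨l, hl⟩ := hxQ n
    have h2 : IsSelfAdjoint (x * Q n) := by
      rw [hl]
      have a1 : IsSelfAdjoint (l : ℂ) := by simp [IsSelfAdjoint]
      have a2 : IsSelfAdjoint ((1 / 2 : ℂ) ^ n) := by simp [IsSelfAdjoint]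
      exact (a1.smul (hQ n).isSelfAdjoint).add (a2.smul
        ((IsSelfAdjoint.commute_iff (hrsa n) (hQ n).isSelfAdjoint).mp (hrQ n)))
    exact (IsSelfAdjoint.commute_iff hx (hQ n).isSelfAdjoint).mpr h2
  -- differences
  have hdp : ∀ n, IsStarProjection (Q n - Q (n + 1)) := by
    intro n
    refine ⟨?_, (hQ n).isSelfAdjoint.sub (hQ (n + 1)).isSelfAdjoint⟩
    have e1 := hQmn n (n + 1) (Nat.le_succ n)
    have e2 := hQnm n (n + 1) (Nat.le_succ n)
    simp only [IsIdempotentElem, mul_sub, sub_mul, e1, e2, (hQ n).isIdempotentElem.eq,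
      (hQ (n + 1)).isIdempotentElem.eq]
    abel
  have hdo : ∀ m n, m ≠ n → (Q m - Q (m + 1)) * (Q n - Q (n + 1)) = 0 := by
    intro m n h
    rcases lt_or_gt_of_ne h with h | h
    · simp only [mul_sub, sub_mul]
      rw [hQmn m n h.le, hQmn (m + 1) n h, hQmn m (n + 1) (by omega),
        hQmn (m + 1) (n + 1) (by omega)]
      abel
    · simp only [mul_sub, sub_mul]
      rw [hQnm n m h.le, hQnm n (m + 1) (by omega), hQnm (n + 1) m h,
        hQnm (n + 1) (m + 1) (by omega)]
      abel
  have hev : ∀ᶠ n in atTop, s * (Q n - Q (n + 1)) = 0 := by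
    by_contra hc
    obtain ⟨φ, hφ, hφ'⟩ := extraction_of_frequently_atTop (Filter.not_eventually.mp hc)
    exact annAux_hump S hS s r hr1 hSr (fun n => Q (φ n) - Q (φ n + 1)) (fun n => hdp _)
      (fun m n h => hdo _ _ (fun h' => h (hφ.injective h'))) hφ'
  obtain ⟨N, hN⟩ := eventually_atTop.mp hev
  set y := s * Q N with hy
  have hyn : ∀ n, N ≤ n → s * Q n = y := by
    intro n h
    induction n, h using Nat.le_induction with
    | base => rfl
    | succ n h ih =>
      have := hN n h
      rw [mul_sub, sub_eq_zero] at this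
      rw [← this, ih]
  have hy0 : y ≠ 0 := hsQ N
  have hyQ : ∀ n, N ≤ n → y * Q n = y := by
    intro n h
    rw [hy, mul_assoc, hQmn N n h, hyn n h]
  -- y * x is a real multiple of y
  choose l hl using hxQ
  have hyx : ∀ n, N ≤ n → y * x - (l n : ℂ) • y = ((1 / 2 : ℂ) ^ n) • (y * r n) := by
    intro n h
    have e : y * x = y * (x * Q n) := by
      rw [(hxcomm n).eq, ← mul_assoc, hyQ n h]
    rw [e, hl n, (hrQ n).eq, mul_add, mul_smul_comm, mul_smul_comm, ← mul_assoc, hyQ n h]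
    abel
  have hlim : Tendsto (fun n => (l n : ℂ) • y) atTop (𝓝 (y * x)) := by
    rw [tendsto_iff_norm_sub_tendsto_zero]
    have hg : Tendsto (fun n : ℕ => (1 / 2 : ℝ) ^ n * ‖y‖) atTop (𝓝 0) := by
      simpa using (tendsto_pow_atTop_nhds_zero_of_lt_one (r := (1 / 2 : ℝ)) (by norm_num)
        (by norm_num)).mul_const ‖y‖
    refine squeeze_zero' (Eventually.of_forall fun n => norm_nonneg _) ?_ hg
    filter_upwards [eventually_ge_atTop N] with n hn
    rw [norm_sub_rev, hyx n hn, norm_smul, norm_pow]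
    have h3 : ‖(1 / 2 : ℂ)‖ = 1 / 2 := by simp
    rw [h3]
    gcongr
    exact (norm_mul_le _ _).trans (mul_le_of_le_one_right (norm_nonneg _) (hr1 n))
  have hmem : y * x ∈ (Submodule.span ℝ {y} : Submodule ℝ A) := by
    have hcl : IsClosed ((Submodule.span ℝ {y} : Submodule ℝ A) : Set A) :=
      Submodule.closed_of_finiteDimensional _
    refine hcl.mem_of_tendsto hlim (Eventually.of_forall fun n => ?_)
    exact Submodule.mem_span_singleton.mpr ⟨l n, by simp⟩
  obtain ⟨t, ht⟩ := Submodule.mem_span_singleton.mp hmem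
  have ht' : y * x = (t : ℂ) • y := by rw [← ht]; simp
  have htsa : IsSelfAdjoint ((t : ℂ) • (1 : A)) := by
    have a1 : IsSelfAdjoint (t : ℂ) := by simp [IsSelfAdjoint]
    exact a1.smul (IsSelfAdjoint.one A)
  have hasa : IsSelfAdjoint (x - (t : ℂ) • (1 : A)) := hx.sub htsa
  obtain ⟨k, hk, hak, hky⟩ := H1 _ hasa
  have hxk : x * k = (t : ℂ) • k := by
    simpa [sub_mul, sub_eq_zero] using hak
  have hsk : s * k = 0 := by
    rw [hsdef, ← hS x k hk, hxk, map_smul, hS0 k hk, smul_zero]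
  -- k commutes with Q N
  have h1 : k * (Q N * k) = Q N * k := by
    apply hky
    rw [sub_mul, ← mul_assoc, (hxcomm N).eq, mul_assoc, hxk]
    simp
  have h2 : k * (Q N * k) = k * Q N := by
    have := congrArg star h1
    simpa [star_mul, hk.isSelfAdjoint.star_eq, (hQ N).isSelfAdjoint.star_eq, mul_assoc] using this
  have hyk : y * k = y := by
    have : (x - (t : ℂ) • (1 : A)) * star y = 0 := by
      have h3 : y * (x - (t : ℂ) • (1 : A)) = 0 := by simp [mul_sub, ht']
      have := congrArg star h3
      rwa [star_mul, hasa.star_eq, star_zero] at this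
    have := congrArg star (hky _ this)
    rwa [star_mul, star_star, hk.isSelfAdjoint.star_eq] at this
  apply hy0
  rw [← hyk, hy, mul_assoc, ← h1, h2, ← mul_assoc, hsk, zero_mul]

theorem annAux_main {A : Type*} [NormedRing A] [StarRing A] [CStarRing A] [NormedAlgebra ℂ A]
    [StarModule ℂ A] [CompleteSpace A]
    (H1 : ∀ a : A, IsSelfAdjoint a → ∃ k, IsStarProjection k ∧ a * k = 0 ∧
      ∀ y, a * y = 0 → k * y = y)
    (H2 : ∀ c : A, IsSelfAdjoint c → ‖c‖ ≤ 1 → ∃ p, IsStarProjection p ∧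
      (∀ b, IsSelfAdjoint b → Commute c b → Commute p b) ∧ ‖(2 : ℂ) • c - ((2 : ℂ) • p - 1)‖ ≤ 1)
    (T : A →ₗ[ℂ] A) (hT : ∀ a b : A, a * b = 0 → T a * b = 0) (a : A) : T a = T 1 * a := by
  have hTp : ∀ a p : A, IsStarProjection p → T (a * p) = T a * p := by
    intro a p hp
    have e := hp.isIdempotentElem.eq
    have h1 : T (a * p) * (1 - p) = 0 := hT _ _ (by simp [mul_sub, mul_assoc, e])
    have h2 : T (a * (1 - p)) * p = 0 := hT _ _ (by simp [sub_mul, mul_assoc, e])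
    rw [mul_sub, mul_one, sub_eq_zero] at h1
    rw [mul_sub, mul_one, map_sub, sub_mul, sub_eq_zero] at h2
    rw [h1, h2]
  let S : A →ₗ[ℂ] A := T - LinearMap.mulLeft ℂ (T 1)
  have hSd : ∀ a, S a = T a - T 1 * a := fun a => rfl
  have hS : ∀ a p : A, IsStarProjection p → S (a * p) = S a * p := by
    intro a p hp
    rw [hSd, hSd, hTp a p hp, sub_mul, mul_assoc]
  have hS0 : ∀ p : A, IsStarProjection p → S p = 0 := by
    intro p hp
    have := hTp 1 p hp
    rw [one_mul] at this
    rw [hSd, this, sub_self]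
  have hsa : ∀ x : A, IsSelfAdjoint x → S x = 0 := by
    intro x hx
    have hpos : (0 : ℝ) < ‖x‖ + 1 := by positivity
    have h0 : (((‖x‖ + 1)⁻¹ : ℝ) : ℂ) ≠ 0 := by
      exact_mod_cast (inv_pos.mpr hpos).ne'
    have hsm : IsSelfAdjoint (((‖x‖ + 1)⁻¹ : ℝ) : ℂ) := Complex.conj_ofReal _
    have h := annAux_zero H1 H2 S hS hS0 ((((‖x‖ + 1)⁻¹ : ℝ) : ℂ) • x) (hsm.smul hx) (by
      rw [norm_smul, Complex.norm_real, Real.norm_of_nonneg (inv_pos.mpr hpos).le,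
        inv_mul_le_one₀ hpos]
      linarith)
    rw [map_smul] at h
    exact (smul_eq_zero.mp h).resolve_left h0
  have hall : S a = 0 := by
    rw [← realPart_add_I_smul_imaginaryPart a, map_add, map_smul,
      hsa _ (realPart a).2, hsa _ (imaginaryPart a).2]
    simp
  rw [hSd, sub_eq_zero] at hall
  exact hall

end AnnAux

section AnnAux2

theorem annAux_mem {H : Type*} [NormedAddCommGroup H] [InnerProductSpace ℂ H] [CompleteSpace H]
    (M : VonNeumannAlgebra H) (z : H →L[ℂ] H)
    (h : ∀ g ∈ M.commutant, g * z = z * g) : z ∈ M := by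
  rw [← M.commutant_commutant, VonNeumannAlgebra.mem_commutant_iff]
  exact h

theorem annAux_H1 {H : Type*} [NormedAddCommGroup H] [InnerProductSpace ℂ H] [CompleteSpace H]
    (M : VonNeumannAlgebra H) (a : H →L[ℂ] H) (ha : a ∈ M) :
    ∃ k ∈ M, IsStarProjection k ∧ a * k = 0 ∧ ∀ y : H →L[ℂ] H, a * y = 0 → k * y = y := by
  have hcl : IsClosed ((LinearMap.ker (a : H →ₗ[ℂ] H) : Submodule ℂ H) : Set H) :=
    ContinuousLinearMap.isClosed_ker a
  haveI : CompleteSpace (LinearMap.ker (a : H →ₗ[ℂ] H) : Submodule ℂ H) :=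
    hcl.completeSpace_coe
  set U : Submodule ℂ H := LinearMap.ker (a : H →ₗ[ℂ] H) with hU
  have hmemU : ∀ v, v ∈ U ↔ a v = 0 := fun v => by simp [hU]
  have hp : IsStarProjection U.starProjection := isStarProjection_starProjection
  refine ⟨U.starProjection, ?_, hp, ?_, ?_⟩
  · rw [VonNeumannAlgebra.IsStarProjection.mem_iff hp]
    intro y hy
    rw [Module.End.mem_invtSubmodule]
    rintro v ⟨w, rfl⟩
    have h1 : U.starProjection w ∈ U := U.starProjection_apply_mem w
    refine ⟨y (U.starProjection w), ?_⟩
    show U.starProjection (y (U.starProjection w)) = y (U.starProjection w)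
    rw [Submodule.starProjection_eq_self_iff, hmemU]
    have h2 := VonNeumannAlgebra.mem_commutant_iff.mp hy a ha
    have h3 := congrArg (fun f : H →L[ℂ] H => f (U.starProjection w)) h2
    simp only [ContinuousLinearMap.mul_apply] at h3
    rw [h3, (hmemU _).mp h1, map_zero]
  · ext w
    exact (hmemU _).mp (U.starProjection_apply_mem w)
  · intro y hy
    ext w
    show U.starProjection (y w) = y w
    rw [Submodule.starProjection_eq_self_iff, hmemU]
    exact congrArg (fun f : H →L[ℂ] H => f w) hy

theorem annAux_H2 {H : Type*} [NormedAddCommGroup H] [InnerProductSpace ℂ H] [CompleteSpace H]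
    (M : VonNeumannAlgebra H) (c : H →L[ℂ] H) (hc : c ∈ M) (hsa : IsSelfAdjoint c)
    (hc1 : ‖c‖ ≤ 1) :
    ∃ p ∈ M, IsStarProjection p ∧
      (∀ b, IsSelfAdjoint b → Commute c b → Commute p b) ∧
      ‖(2 : ℂ) • c - ((2 : ℂ) • p - 1)‖ ≤ 1 := by
  set u : H →L[ℂ] H := cfc (fun t : ℝ => max t 0) c with hu
  set v : H →L[ℂ] H := cfc (fun t : ℝ => max (-t) 0) c with hv
  have husa : IsSelfAdjoint u := cfc_predicate _ _
  have huM : u ∈ M := by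
    apply annAux_mem
    intro g hg
    have h1 : Commute c g := VonNeumannAlgebra.mem_commutant_iff.mp hg c hc
    exact (h1.cfc_real _).symm.eq
  have huv : u * v = 0 := by
    rw [hu, hv, ← cfc_mul _ _ c (by fun_prop) (by fun_prop)]
    have : (fun t : ℝ => max t 0 * max (-t) 0) = fun _ => 0 := by
      funext t
      rcases le_total t 0 with h | h
      · simp [h]
      · simp [h]
    rw [this]
    simp
  have huvc : u - v = c := by
    rw [hu, hv, ← cfc_sub _ _ c (by fun_prop) (by fun_prop)]
    have : (fun t : ℝ => max t 0 - max (-t) 0) = id := by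
      funext t
      rcases le_total t 0 with h | h
      · simp [h]
      · simp [h]
    rw [this, cfc_id ℝ c]
  have hnorm : ‖(2 : ℂ) • (u + v) - 1‖ ≤ 1 := by
    have : (2 : ℂ) • (u + v) - 1 = cfc (fun t : ℝ => 2 * (max t 0 + max (-t) 0) - 1) c := by
      rw [cfc_sub _ _ c (by fun_prop) (by fun_prop), cfc_const_mul _ _ c (by fun_prop),
        cfc_add c _ _ (by fun_prop) (by fun_prop), cfc_const_one ℝ c, two_smul, two_smul]
    rw [this]
    refine norm_cfc_le zero_le_one ?_
    intro t ht
    have h1 : ‖t‖ ≤ 1 := (spectrum.norm_le_norm_mul_of_mem ht).trans (by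
      calc ‖c‖ * ‖(1 : H →L[ℂ] H)‖ ≤ 1 * 1 := by
            gcongr
            exact ContinuousLinearMap.norm_id_le
        _ = 1 := one_mul 1)
    rw [Real.norm_eq_abs, abs_le] at h1 ⊢
    rcases le_total t 0 with h | h
    · rw [max_eq_right h, max_eq_left (by linarith)]
      constructor <;> linarith
    · rw [max_eq_left h, max_eq_right (by linarith)]
      constructor <;> linarith
  obtain ⟨k, hkM, hk, huk, hky⟩ := annAux_H1 M u huM
  have hku : k * u = 0 := by
    have := congrArg star huk
    rwa [star_mul, hk.isSelfAdjoint.star_eq, husa.star_eq, star_zero] at this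
  have hkv : k * v = v := hky v huv
  have hkk : k * k = k := hk.isIdempotentElem.eq
  refine ⟨1 - k, sub_mem (one_mem M) hkM, hk.one_sub, ?_, ?_⟩
  · intro b hb hcb
    have hub : Commute u b := hcb.cfc_real _
    have h1 : k * (b * k) = b * k := by
      apply hky
      rw [← mul_assoc, hub.eq, mul_assoc, huk, mul_zero]
    have h2 : k * (b * k) = k * b := by
      have := congrArg star h1
      simpa [star_mul, hk.isSelfAdjoint.star_eq, hb.star_eq, mul_assoc] using this
    have h3 : Commute k b := by rw [commute_iff_eq, ← h2, h1]
    exact (Commute.one_left b).sub_left h3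
  · set e : H →L[ℂ] H := 1 - (2 : ℂ) • k with he
    have hesa : star e = e := by
      simp [he, hk.isSelfAdjoint.star_eq]
    have hee : e * e = 1 := by
      simp only [he, two_smul]
      simp only [mul_sub, sub_mul, mul_add, add_mul, hkk, mul_one, one_mul]
      abel
    have hen : ‖e‖ ≤ 1 := by
      have h1 : ‖e‖ * ‖e‖ ≤ 1 := by
        rw [← CStarRing.norm_star_mul_self (x := e), hesa, hee]
        exact ContinuousLinearMap.norm_id_le
      nlinarith [norm_nonneg e]
    have heq : (2 : ℂ) • c - ((2 : ℂ) • (1 - k) - 1) = e * ((2 : ℂ) • (u + v) - 1) := by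
      simp only [he, two_smul, ← huvc]
      simp only [mul_sub, sub_mul, mul_add, add_mul, hkk, mul_one, one_mul, hku, hkv]
      abel
    rw [heq]
    exact (norm_mul_le _ _).trans (mul_le_one₀ hen (norm_nonneg _) hnorm)

theorem annAux_vN {H : Type*} [NormedAddCommGroup H] [InnerProductSpace ℂ H] [CompleteSpace H]
    (M : VonNeumannAlgebra H) (T : M.toStarSubalgebra →ₗ[ℂ] M.toStarSubalgebra)
    (hT : ∀ a b, a * b = 0 → T a * b = 0) (a : M.toStarSubalgebra) : T a = T 1 * a := by
  have hclosed : IsClosed ((M.toStarSubalgebra : StarSubalgebra ℂ (H →L[ℂ] H)) :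
      Set (H →L[ℂ] H)) := by
    have : ((M.toStarSubalgebra : StarSubalgebra ℂ (H →L[ℂ] H)) : Set (H →L[ℂ] H)) =
      Set.centralizer (Set.centralizer (M : Set (H →L[ℂ] H))) := by
        rw [M.centralizer_centralizer]; rfl
    rw [this]
    exact Set.isClosed_centralizer _
  haveI : CompleteSpace M.toStarSubalgebra := hclosed.completeSpace_coe
  have hproj : ∀ (k : H →L[ℂ] H) (hk : k ∈ M), IsStarProjection k →
      IsStarProjection (⟨k, hk⟩ : M.toStarSubalgebra) := fun k hk h =>
    ⟨Subtype.ext h.isIdempotentElem.eq, Subtype.ext h.isSelfAdjoint.star_eq⟩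
  refine annAux_main ?_ ?_ T hT a
  · intro a _
    obtain ⟨k, hkM, hk, h1, h2⟩ := annAux_H1 M a.1 a.2
    exact ⟨⟨k, hkM⟩, hproj k hkM hk, Subtype.ext h1,
      fun y hy => Subtype.ext (h2 y.1 (congrArg Subtype.val hy))⟩
  · intro c hc hc1
    obtain ⟨p, hpM, hp, h1, h2⟩ := annAux_H2 M c.1 c.2 (congrArg Subtype.val hc) hc1
    exact ⟨⟨p, hpM⟩, hproj p hpM hp, fun b hb hcb =>
      Subtype.ext (h1 b.1 (congrArg Subtype.val hb) (congrArg Subtype.val hcb)), h2⟩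

end AnnAux2

/-- Every linear left-annihilator-preserving map on a von Neumann algebra is continuous and
is a left multiplier. -/
theorem left_annihilator_preserving_on_vN (M : VonNeumannAlgebra H) (T : ↥M → ↥M)
    (hlin : IsLinearMap ℂ T) (hann : ∀ a b : ↥M, a * b = 0 → T a * b = 0) :
    Continuous T ∧ ∀ a b : ↥M, T (a * b) = T a * b := by
  have key : ∀ a : ↥M, T a = T 1 * a := by
    intro a
    let T' : M.toStarSubalgebra →ₗ[ℂ] M.toStarSubalgebra :=
      { toFun := T
        map_add' := hlin.map_add
        map_smul' := hlin.map_smul }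
    exact annAux_vN M T' hann a
  refine ⟨?_, fun a b => ?_⟩
  · have : T = fun a => T 1 * a := funext key
    rw [this]
    exact continuous_const.mul continuous_id
  · rw [key (a * b), key a, mul_assoc]
end

section
/- Every weak*-local derivation on a von Neumann algebra is continuous. -/
open scoped ComplexOrder InnerProductSpace

variable {H : Type*} [NormedAddCommGroup H] [InnerProductSpace ℂ H] [CompleteSpace H]

open Filter Topology

/-- The self-adjoint part of `M`, as a real subspace of `B(H)`. -/
def wslSA (M : VonNeumannAlgebra H) : Submodule ℝ (H →L[ℂ] H) where
  carrier := {x | x ∈ M ∧ IsSelfAdjoint x}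
  add_mem' := fun ha hb => ⟨add_mem ha.1 hb.1, ha.2.add hb.2⟩
  zero_mem' := ⟨zero_mem M, IsSelfAdjoint.zero _⟩
  smul_mem' := fun c _ hx => ⟨by
    have := SMulMemClass.smul_mem (s := M) (c : ℂ) hx.1
    simpa using this, (IsSelfAdjoint.all c).smul hx.2⟩

theorem wsl_isClosed (M : VonNeumannAlgebra H) : IsClosed (M : Set (H →L[ℂ] H)) := by
  rw [← M.centralizer_centralizer]
  exact Set.isClosed_centralizer _

theorem wslSA_isClosed (M : VonNeumannAlgebra H) : IsClosed (wslSA M : Set (H →L[ℂ] H)) := by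
  have h : (wslSA M : Set (H →L[ℂ] H)) = (M : Set (H →L[ℂ] H)) ∩ {x | star x = x} := by
    ext x; rfl
  rw [h]
  exact (wsl_isClosed M).inter (isClosed_eq continuous_star continuous_id)

theorem wsl_cfc_mem (M : VonNeumannAlgebra H) {x : H →L[ℂ] H} (hx : x ∈ M) (f : ℝ → ℝ) :
    cfc f x ∈ M := by
  rw [← M.commutant_commutant, VonNeumannAlgebra.mem_commutant_iff]
  intro g hg
  rw [VonNeumannAlgebra.mem_commutant_iff] at hg
  exact ((show Commute x g from hg x hx).cfc_real f).eq.symm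

theorem wsl_cfc_mem_SA (M : VonNeumannAlgebra H) {x : H →L[ℂ] H} (hx : x ∈ M) (f : ℝ → ℝ) :
    cfc f x ∈ wslSA M := ⟨wsl_cfc_mem M hx f, cfc_predicate f x⟩

theorem wsl_one_mem (M : VonNeumannAlgebra H) : (1 : H →L[ℂ] H) ∈ wslSA M :=
  ⟨one_mem M, IsSelfAdjoint.one _⟩

theorem wsl_sq_apply {r : H →L[ℂ] H} (hr : IsSelfAdjoint r) {ξ : H} (h : r (r ξ) = 0) :
    r ξ = 0 := by
  have h1 : ⟪r ξ, r ξ⟫_ℂ = ⟪ξ, r (r ξ)⟫_ℂ := by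
    have := ContinuousLinearMap.adjoint_inner_left r (r ξ) ξ
    rwa [hr.adjoint_eq] at this
  rw [h, inner_zero_right] at h1
  exact inner_self_eq_zero.1 h1

/-- Unit vector from a nonzero operator, in its range. -/
theorem wsl_unit {g : H →L[ℂ] H} (hg : g ≠ 0) : ∃ v : H, ‖g v‖ = 1 := by
  obtain ⟨v, hv⟩ : ∃ v, g v ≠ 0 := by
    by_contra! h
    exact hg (ContinuousLinearMap.ext h)
  refine ⟨((‖g v‖⁻¹ : ℝ) : ℂ) • v, ?_⟩
  rw [map_smul, norm_smul]
  simp [norm_ne_zero_iff.2 hv]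

theorem wsl_cfc_ne_zero {k : H →L[ℂ] H} (hk : IsSelfAdjoint k) {g : ℝ → ℝ} (hg : Continuous g)
    {t : ℝ} (ht : t ∈ spectrum ℝ k) (h : g t ≠ 0) : cfc g k ≠ 0 := by
  intro h0
  have h1 : g t ∈ spectrum ℝ (cfc g k) := by
    rw [cfc_map_spectrum g k hk hg.continuousOn]
    exact ⟨t, ht, rfl⟩
  rw [h0] at h1
  by_cases hn : Nontrivial (H →L[ℂ] H)
  · rw [spectrum.zero_eq] at h1
    exact h h1
  · have := not_nontrivial_iff_subsingleton.1 hn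
    simp [spectrum.of_subsingleton] at h1

/-- If `f g = F g` on the spectrum, then `f(k)` and `F(k)` agree on the range of `g(k)`. -/
theorem wsl_agree {k : H →L[ℂ] H} (hk : IsSelfAdjoint k) {f F g : ℝ → ℝ} (hf : Continuous f)
    (hF : Continuous F) (hg : Continuous g) (h : ∀ t ∈ spectrum ℝ k, f t * g t = F t * g t)
    (v : H) : cfc f k (cfc g k v) = cfc F k (cfc g k v) := by
  have h1 : cfc f k * cfc g k = cfc F k * cfc g k := by
    rw [← cfc_mul f g k hf.continuousOn hg.continuousOn,
      ← cfc_mul F g k hF.continuousOn hg.continuousOn]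
    exact cfc_congr h
  exact congrArg (fun A : H →L[ℂ] H => A v) h1

/-- The concave function with unbounded slopes. -/
noncomputable def wslF (s : ℕ → ℝ) (t : ℝ) : ℝ := ∑' j, (1/2 : ℝ)^j * min (max t 0 / s j) 1

theorem wslF_bound (s : ℕ → ℝ) (hs : ∀ n, 0 < s n) (j : ℕ) (t : ℝ) :
    ‖(1/2 : ℝ)^j * min (max t 0 / s j) 1‖ ≤ (1/2 : ℝ)^j := by
  have h0 : 0 ≤ min (max t 0 / s j) 1 :=
    le_min (div_nonneg (le_max_right _ _) (hs j).le) zero_le_one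
  rw [Real.norm_of_nonneg (by positivity)]
  exact mul_le_of_le_one_right (by positivity) (min_le_right _ _)

theorem wslF_continuous (s : ℕ → ℝ) (hs : ∀ n, 0 < s n) : Continuous (wslF s) := by
  refine continuous_tsum (u := fun j => (1/2 : ℝ)^j) (fun j => by fun_prop) ?_ (wslF_bound s hs)
  exact summable_geometric_of_lt_one (by norm_num) (by norm_num)

theorem wslF_affine (s : ℕ → ℝ) (hs : ∀ n, 0 < s n) (ha : Antitone s) (h4 : ∀ n, s n ≤ (1/4 : ℝ)^n)
    (n : ℕ) : ∃ c d : ℝ, (2 : ℝ)^n ≤ c ∧ ∀ t, s (n+1) ≤ t → t ≤ s n → wslF s t = c * t + d := by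
  refine ⟨∑ j ∈ Finset.range (n+1), (1/2 : ℝ)^j / s j, ∑' j, (1/2 : ℝ)^(j + (n+1)), ?_, ?_⟩
  · refine le_trans ?_ (Finset.single_le_sum (f := fun j => (1/2 : ℝ)^j / s j)
      (fun j _ => by have := hs j; positivity) (Finset.mem_range.2 (Nat.lt_succ_self n)))
    rw [le_div_iff₀ (hs n)]
    calc (2:ℝ)^n * s n ≤ 2^n * (1/4)^n := by gcongr; exact h4 n
      _ = (1/2)^n := by rw [← mul_pow]; norm_num
  · intro t h1 h2
    have ht : 0 < t := lt_of_lt_of_le (hs _) h1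
    have hsum : Summable fun j => (1/2 : ℝ)^j * min (max t 0 / s j) 1 :=
      Summable.of_norm_bounded (summable_geometric_of_lt_one (by norm_num) (by norm_num))
        (fun j => wslF_bound s hs j t)
    unfold wslF
    rw [← hsum.sum_add_tsum_nat_add (n+1), Finset.sum_mul]
    congr 1
    · refine Finset.sum_congr rfl fun j hj => ?_
      have : t ≤ s j := h2.trans (ha (Nat.lt_succ_iff.1 (Finset.mem_range.1 hj)))
      rw [max_eq_left ht.le, min_eq_left ((div_le_one (hs j)).2 this)]
      ring
    · refine tsum_congr fun j => ?_
      have : s (j + (n+1)) ≤ t := (ha (Nat.le_add_left _ _)).trans h1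
      rw [max_eq_left ht.le, min_eq_right ((one_le_div (hs _)).2 this), mul_one]

/-- The gliding hump. -/
theorem wsl_approx (M : VonNeumannAlgebra H) (S : wslSA M →ₗ[ℝ] wslSA M)
    (hS : ∀ (x : wslSA M) (ξ : H) (c : ℝ), (x : H →L[ℂ] H) ξ = (c : ℂ) • ξ →
      ⟪ξ, (S x : H →L[ℂ] H) ξ⟫_ℂ = 0)
    (k : wslSA M) (hpos : ∀ t ∈ spectrum ℝ (k : H →L[ℂ] H), 0 ≤ t)
    (h0 : (0 : ℝ) ∈ spectrum ℝ (k : H →L[ℂ] H)) (ε : ℝ) (hε : 0 < ε) :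
    ∃ ξ : H, ‖ξ‖ = 1 ∧ ‖(k : H →L[ℂ] H) ξ‖ ≤ ε ∧ ‖⟪ξ, (S k : H →L[ℂ] H) ξ⟫_ℂ‖ ≤ ε := by
  have hk : IsSelfAdjoint (k : H →L[ℂ] H) := k.2.2
  have hid : cfc (fun t : ℝ => t) (k : H →L[ℂ] H) = k := cfc_id' ℝ (k : H →L[ℂ] H)
  by_cases hA : ∀ r : ℝ, 0 < r → ∃ t ∈ spectrum ℝ (k : H →L[ℂ] H), 0 < t ∧ t < r
  · by_contra! hcon
    choose! τ hτ using hA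
    let s : ℕ → ℝ := fun n => Nat.rec 1 (fun _ r => τ r / 4) n
    have s0 : s 0 = 1 := rfl
    have s1 : ∀ n, s (n+1) = τ (s n) / 4 := fun n => rfl
    have hs : ∀ n, 0 < s n := by
      intro n
      induction n with
      | zero => rw [s0]; norm_num
      | succ n ih => rw [s1]; have := (hτ _ ih).2.1; positivity
    have hq : ∀ n, s (n+1) ≤ s n / 4 := fun n => by
      rw [s1]; have := (hτ _ (hs n)).2.2; linarith
    have ha : Antitone s := antitone_nat_of_succ_le fun n => by
      have := hq n; have := hs n; linarith
    have h4 : ∀ n, s n ≤ (1/4 : ℝ)^n := by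
      intro n
      induction n with
      | zero => rw [s0]; norm_num
      | succ n ih => have := hq n; rw [pow_succ]; linarith
    have hFc := wslF_continuous s hs
    let x : wslSA M := ⟨cfc (wslF s) (k : H →L[ℂ] H), wsl_cfc_mem_SA M k.2.1 _⟩
    have key : ∀ n, s n ≤ ε → (2:ℝ)^n * ε ≤ ‖(S x : H →L[ℂ] H)‖ := by
      intro n hn
      obtain ⟨c, d, hc, hcd⟩ := wslF_affine s hs ha h4 n
      obtain ⟨ht, ht0, ht1⟩ := hτ _ (hs n)
      let g : ℝ → ℝ := fun t => max 0 ((t - s (n+1)) * (s n - t))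
      have hg : Continuous g := by fun_prop
      have hgz : ∀ t, ¬ (s (n+1) ≤ t ∧ t ≤ s n) → g t = 0 := by
        intro t h
        refine max_eq_left ?_
        by_contra hcc
        have h' := not_le.1 hcc
        have := ha (Nat.le_succ n)
        rcases pos_and_pos_or_neg_and_neg_of_mul_pos h' with h'' | h''
        · exact h ⟨by linarith, by linarith⟩
        · linarith
      have hne : cfc g (k : H →L[ℂ] H) ≠ 0 := by
        refine wsl_cfc_ne_zero hk hg ht ?_
        have : 0 < (τ (s n) - s (n+1)) * (s n - τ (s n)) := by
          rw [s1]
          exact mul_pos (by linarith) (by linarith)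
        exact (lt_max_of_lt_right this).ne'
      obtain ⟨v, hv⟩ := wsl_unit hne
      set ξ := cfc g (k : H →L[ℂ] H) v with hξ
      have e1 : (k : H →L[ℂ] H) ξ = cfc (fun t => max (min t (s n)) 0) (k : H →L[ℂ] H) ξ := by
        conv_lhs => rw [← hid]
        refine wsl_agree hk (by fun_prop) (by fun_prop) hg ?_ v
        intro t ht
        rcases Classical.em (s (n+1) ≤ t ∧ t ≤ s n) with h | h
        · rw [min_eq_left h.2, max_eq_left (hpos t ht)]
        · rw [hgz t h, mul_zero, mul_zero]
      have e2 : ‖(k : H →L[ℂ] H) ξ‖ ≤ ε := by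
        rw [e1]
        refine (ContinuousLinearMap.le_opNorm _ _).trans ?_
        rw [hv, mul_one]
        refine (norm_cfc_le (hs n).le ?_).trans hn
        intro t _
        rw [Real.norm_of_nonneg (le_max_right _ _)]
        exact max_le (min_le_right _ _) (hs n).le
      have e3 := hcon ξ hv e2
      have e4 : ((x - c • k : wslSA M) : H →L[ℂ] H) ξ = (d : ℂ) • ξ := by
        have : cfc (wslF s) (k : H →L[ℂ] H) ξ = cfc (fun t => c * t + d) (k : H →L[ℂ] H) ξ := by
          refine wsl_agree hk hFc (by fun_prop) hg ?_ v
          intro t ht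
          rcases Classical.em (s (n+1) ≤ t ∧ t ≤ s n) with h | h
          · simp only [hcd t h.1 h.2]
          · rw [hgz t h, mul_zero, mul_zero]
        have h2 : cfc (fun t => c * t + d) (k : H →L[ℂ] H) = c • (k : H →L[ℂ] H) + d • 1 := by
          rw [cfc_add_const d (fun t => c * t) (k : H →L[ℂ] H) (by fun_prop) hk,
            cfc_const_mul c (fun t => t) (k : H →L[ℂ] H) (by fun_prop), hid,
            Algebra.algebraMap_eq_smul_one]
        rw [h2] at this
        simp only [Submodule.coe_sub, Submodule.coe_smul, sub_apply]
        change cfc (wslF s) (k : H →L[ℂ] H) ξ - _ = _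
        rw [this]
        simp
      have e5 := hS _ _ _ e4
      rw [map_sub, map_smul] at e5
      simp only [Submodule.coe_sub, Submodule.coe_smul, sub_apply,
        smul_apply, inner_sub_right] at e5
      rw [sub_eq_zero, ← Complex.coe_smul, inner_smul_right] at e5
      have hc0 : 0 ≤ c := le_trans (by positivity) hc
      calc (2:ℝ)^n * ε ≤ c * ‖⟪ξ, (S k : H →L[ℂ] H) ξ⟫_ℂ‖ := by gcongr
        _ = ‖⟪ξ, (S x : H →L[ℂ] H) ξ⟫_ℂ‖ := by
          rw [e5, norm_mul, Complex.norm_real, Real.norm_of_nonneg hc0]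
        _ ≤ ‖ξ‖ * ‖(S x : H →L[ℂ] H) ξ‖ := norm_inner_le_norm _ _
        _ ≤ ‖ξ‖ * (‖(S x : H →L[ℂ] H)‖ * ‖ξ‖) := by
          gcongr; exact ContinuousLinearMap.le_opNorm _ _
        _ = _ := by rw [hv]; ring
    have l1 : ∀ᶠ n in atTop, s n ≤ ε := by
      have : Tendsto (fun n : ℕ => (1/4 : ℝ)^n) atTop (𝓝 0) :=
        tendsto_pow_atTop_nhds_zero_of_lt_one (by norm_num) (by norm_num)
      filter_upwards [this.eventually (gt_mem_nhds hε)] with n hn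
      exact (h4 n).trans hn.le
    have l2 : ∀ᶠ n in atTop, ‖(S x : H →L[ℂ] H)‖ / ε < (2:ℝ)^n :=
      (tendsto_pow_atTop_atTop_of_one_lt (by norm_num : (1:ℝ) < 2)).eventually_gt_atTop _
    obtain ⟨n, hn1, hn2⟩ := (l1.and l2).exists
    rw [div_lt_iff₀ hε] at hn2
    exact absurd (key n hn1) (not_le.2 hn2)
  · push Not at hA
    obtain ⟨r, hr, hA⟩ := hA
    let g : ℝ → ℝ := fun t => max 0 (r - t)
    have hg : Continuous g := by fun_prop
    have hne : cfc g (k : H →L[ℂ] H) ≠ 0 :=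
      wsl_cfc_ne_zero hk hg h0 (by simp [g, hr])
    obtain ⟨v, hv⟩ := wsl_unit hne
    have e1 : (k : H →L[ℂ] H) (cfc g (k : H →L[ℂ] H) v) = 0 := by
      have : cfc (fun t : ℝ => t) (k : H →L[ℂ] H) (cfc g (k : H →L[ℂ] H) v)
          = cfc (fun _ : ℝ => (0:ℝ)) (k : H →L[ℂ] H) (cfc g (k : H →L[ℂ] H) v) := by
        refine wsl_agree hk (by fun_prop) (by fun_prop) hg ?_ v
        intro t ht
        rcases (hpos t ht).eq_or_lt with h | h
        · rw [← h]
        · have : g t = 0 := max_eq_left (by linarith [hA t ht h])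
          rw [this, mul_zero, mul_zero]
      rw [hid] at this
      rw [this]
      simp
    refine ⟨_, hv, ?_, ?_⟩
    · rw [e1, norm_zero]; exact hε.le
    · rw [hS k _ 0 (by rw [e1]; simp), norm_zero]; exact hε.le

theorem wsl_approx_max [Nontrivial H] (M : VonNeumannAlgebra H) (S : wslSA M →ₗ[ℝ] wslSA M)
    (hS : ∀ (x : wslSA M) (ξ : H) (c : ℝ), (x : H →L[ℂ] H) ξ = (c : ℂ) • ξ →
      ⟪ξ, (S x : H →L[ℂ] H) ξ⟫_ℂ = 0) (h : wslSA M) (ε : ℝ) (hε : 0 < ε) :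
    ∃ ξ : H, ‖ξ‖ = 1 ∧ ‖⟪ξ, (S h : H →L[ℂ] H) ξ⟫_ℂ‖ ≤ ε ∧
      ∀ η : H, ‖η‖ = 1 → (⟪η, (h : H →L[ℂ] H) η⟫_ℂ).re ≤ (⟪ξ, (h : H →L[ℂ] H) ξ⟫_ℂ).re + ε := by
  have hh : IsSelfAdjoint (h : H →L[ℂ] H) := h.2.2
  have hcomp : IsCompact (spectrum ℝ (h : H →L[ℂ] H)) := spectrum.isCompact _
  have hne : (spectrum ℝ (h : H →L[ℂ] H)).Nonempty :=
    ContinuousFunctionalCalculus.spectrum_nonempty _ hh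
  obtain ⟨μ, hμ, hmax⟩ := hcomp.exists_isGreatest hne
  let k : wslSA M := μ • ⟨1, wsl_one_mem M⟩ - h
  have hkc : (k : H →L[ℂ] H) = cfc (fun t => μ - t) (h : H →L[ℂ] H) := by
    rw [cfc_sub (fun _ => μ) (fun t => t) (h : H →L[ℂ] H) (by fun_prop) (by fun_prop),
      cfc_const μ (h : H →L[ℂ] H) hh, cfc_id' ℝ (h : H →L[ℂ] H), Algebra.algebraMap_eq_smul_one]
    rfl
  have hspec : spectrum ℝ (k : H →L[ℂ] H) = (fun t => μ - t) '' spectrum ℝ (h : H →L[ℂ] H) := by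
    rw [hkc, cfc_map_spectrum _ _ hh (by fun_prop)]
  obtain ⟨ξ, h1, h2, h3⟩ := wsl_approx M S hS k
    (by rw [hspec]; rintro _ ⟨t, ht, rfl⟩; exact sub_nonneg.2 (hmax ht))
    (by rw [hspec]; exact ⟨μ, hμ, sub_self μ⟩) ε hε
  have hk0 : (0 : H →L[ℂ] H) ≤ k := by
    rw [hkc]; exact cfc_nonneg fun t ht => sub_nonneg.2 (hmax ht)
  rw [ContinuousLinearMap.nonneg_iff_isPositive] at hk0
  have hform : ∀ η : H, ‖η‖ = 1 → (⟪η, (k : H →L[ℂ] H) η⟫_ℂ).re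
      = μ - (⟪η, (h : H →L[ℂ] H) η⟫_ℂ).re := by
    intro η hη
    have : (k : H →L[ℂ] H) η = (μ : ℂ) • η - (h : H →L[ℂ] H) η := by
      simp [k]
    rw [this, inner_sub_right, inner_smul_right, inner_self_eq_norm_sq_to_K, hη]
    simp
  refine ⟨ξ, h1, ?_, ?_⟩
  · have hone := hS ⟨1, wsl_one_mem M⟩ ξ 1 (by simp)
    have : ⟪ξ, (S k : H →L[ℂ] H) ξ⟫_ℂ = - ⟪ξ, (S h : H →L[ℂ] H) ξ⟫_ℂ := by
      have e : S k = μ • S ⟨1, wsl_one_mem M⟩ - S h := by rw [map_sub, map_smul]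
      rw [e]
      simp only [Submodule.coe_sub, Submodule.coe_smul, sub_apply,
        smul_apply, inner_sub_right]
      rw [← Complex.coe_smul, inner_smul_right, hone]
      simp
    rwa [this, norm_neg] at h3
  · intro η hη
    have a1 := hform η hη
    have a2 := hform ξ h1
    have a3 : 0 ≤ (⟪η, (k : H →L[ℂ] H) η⟫_ℂ).re := hk0.re_inner_nonneg_right η
    have a4 : (⟪ξ, (k : H →L[ℂ] H) ξ⟫_ℂ).re ≤ ε := by
      refine (Complex.re_le_norm _).trans ((norm_inner_le_norm _ _).trans ?_)
      rwa [h1, one_mul]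
    linarith

theorem wsl_inner_le (A : H →L[ℂ] H) {ξ : H} (h : ‖ξ‖ = 1) : |(⟪ξ, A ξ⟫_ℂ).re| ≤ ‖A‖ := by
  refine (Complex.abs_re_le_norm _).trans ((norm_inner_le_norm _ _).trans ?_)
  rw [h, one_mul]
  simpa [h] using A.le_opNorm ξ

theorem wsl_sep [Nontrivial H] (M : VonNeumannAlgebra H) (S : wslSA M →ₗ[ℝ] wslSA M)
    (hS : ∀ (x : wslSA M) (ξ : H) (c : ℝ), (x : H →L[ℂ] H) ξ = (c : ℂ) • ξ →
      ⟪ξ, (S x : H →L[ℂ] H) ξ⟫_ℂ = 0) (u : ℕ → wslSA M) (b : wslSA M)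
    (hu : Tendsto u atTop (𝓝 0)) (hb : Tendsto (fun n => S (u n)) atTop (𝓝 b))
    (η : H) (hη : ‖η‖ = 1) : (⟪η, (b : H →L[ℂ] H) η⟫_ℂ).re ≤ 0 := by
  have key : ∀ l : ℝ, 0 < l → ∀ n, (⟪η, (b : H →L[ℂ] H) η⟫_ℂ).re ≤
      (2 * ‖u n‖ + l^2) / l + ‖S (u n) - b‖ + l^2 + l * ‖S b‖ := by
    intro l hl n
    obtain ⟨ξ, h1, h2, h3⟩ := wsl_approx_max M S hS (u n + l • b) (l^2) (by positivity)
    have h3 := h3 η hη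
    have h2 := (abs_le.1 ((Complex.abs_re_le_norm _).trans h2)).2
    have e : ∀ (x y : wslSA M) (ζ : H), (⟪ζ, ((x + l • y : wslSA M) : H →L[ℂ] H) ζ⟫_ℂ).re =
        (⟪ζ, (x : H →L[ℂ] H) ζ⟫_ℂ).re + l * (⟪ζ, (y : H →L[ℂ] H) ζ⟫_ℂ).re := by
      intro x y ζ
      simp only [Submodule.coe_add, Submodule.coe_smul, add_apply, smul_apply, inner_add_right]
      rw [← Complex.coe_smul, inner_smul_right]
      simp
    rw [map_add, map_smul, e] at h2
    rw [e, e] at h3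
    have a1 := abs_le.1 (wsl_inner_le (u n : H →L[ℂ] H) hη)
    have a2 := abs_le.1 (wsl_inner_le (u n : H →L[ℂ] H) h1)
    have a3 := abs_le.1 (wsl_inner_le (S b : H →L[ℂ] H) h1)
    have a4 := abs_le.1 (wsl_inner_le ((S (u n) - b : wslSA M) : H →L[ℂ] H) h1)
    simp only [Submodule.coe_sub, sub_apply, inner_sub_right, Complex.sub_re] at a4
    have n1 : ‖(u n : H →L[ℂ] H)‖ = ‖u n‖ := rfl
    have n2 : ‖(S b : H →L[ℂ] H)‖ = ‖S b‖ := rfl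
    have n3 : ‖(S (u n) : H →L[ℂ] H) - (b : H →L[ℂ] H)‖ = ‖S (u n) - b‖ := rfl
    rw [n1] at a1 a2
    rw [n2] at a3
    rw [n3] at a4
    have b1 : (⟪η, (b : H →L[ℂ] H) η⟫_ℂ).re - (⟪ξ, (b : H →L[ℂ] H) ξ⟫_ℂ).re
        ≤ (2 * ‖u n‖ + l^2) / l := by
      rw [le_div_iff₀ hl]
      nlinarith [a1.1, a2.2]
    have b2 : -(l * ‖S b‖) ≤ l * (⟪ξ, (S b : H →L[ℂ] H) ξ⟫_ℂ).re := by
      nlinarith [a3.1]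
    linarith [a4.1]
  have hu0 : Tendsto (fun n => ‖u n‖) atTop (𝓝 0) := tendsto_zero_iff_norm_tendsto_zero.1 hu
  have hb0 : Tendsto (fun n => ‖S (u n) - b‖) atTop (𝓝 0) :=
    tendsto_iff_norm_sub_tendsto_zero.1 hb
  have key2 : ∀ l : ℝ, 0 < l → (⟪η, (b : H →L[ℂ] H) η⟫_ℂ).re ≤
      (2 * 0 + l^2) / l + 0 + l^2 + l * ‖S b‖ := by
    intro l hl
    refine ge_of_tendsto (x := atTop) ?_ (Eventually.of_forall (key l hl))
    exact (((((hu0.const_mul 2).add_const _).div_const _).add hb0).add_const _).add_const _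
  have key3 : ∀ l : ℝ, 0 < l → (⟪η, (b : H →L[ℂ] H) η⟫_ℂ).re ≤ l + l^2 + l * ‖S b‖ := by
    intro l hl
    have := key2 l hl
    have e : (2 * 0 + l^2) / l = l := by field_simp; ring
    rw [e] at this
    linarith
  have ht : Tendsto (fun l : ℝ => l + l^2 + l * ‖S b‖) (𝓝[>] 0) (𝓝 0) := by
    have hc : Continuous (fun l : ℝ => l + l^2 + l * ‖S b‖) := by fun_prop
    have := hc.tendsto 0
    simp only [zero_mul, add_zero, ne_eq, OfNat.ofNat_ne_zero, not_false_eq_true, zero_pow] at this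
    exact this.mono_left nhdsWithin_le_nhds
  refine ge_of_tendsto ht ?_
  filter_upwards [self_mem_nhdsWithin] with l hl using key3 l hl

theorem wsl_continuous_S (M : VonNeumannAlgebra H) (S : wslSA M →ₗ[ℝ] wslSA M)
    (hS : ∀ (x : wslSA M) (ξ : H) (c : ℝ), (x : H →L[ℂ] H) ξ = (c : ℂ) • ξ →
      ⟪ξ, (S x : H →L[ℂ] H) ξ⟫_ℂ = 0) : Continuous S := by
  have : CompleteSpace (wslSA M) := (wslSA_isClosed M).completeSpace_coe
  rcases subsingleton_or_nontrivial H with hH | hH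
  · have : Subsingleton (wslSA M) := ⟨fun a b => Subtype.ext (by ext x; exact Subsingleton.elim _ _)⟩
    exact continuous_of_const fun x y => Subsingleton.elim _ _
  refine S.continuous_of_seq_closed_graph fun u x y hu hy => ?_
  have hu' : Tendsto (fun n => u n - x) atTop (𝓝 0) := by
    simpa using hu.sub_const x
  have hy' : Tendsto (fun n => S (u n - x)) atTop (𝓝 (y - S x)) := by
    simp only [map_sub]
    exact hy.sub_const _
  have hu2 : Tendsto (fun n => -(u n - x)) atTop (𝓝 0) := by simpa using hu'.neg
  have hy2 : Tendsto (fun n => S (-(u n - x))) atTop (𝓝 (-(y - S x))) := by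
    simp only [map_neg]
    exact hy'.neg
  set b := y - S x with hbdef
  have hre : ∀ η : H, ‖η‖ = 1 → (⟪η, (b : H →L[ℂ] H) η⟫_ℂ).re = 0 := by
    intro η hη
    have h1 := wsl_sep M S hS _ _ hu' hy' η hη
    have h2 := wsl_sep M S hS _ _ hu2 hy2 η hη
    simp only [Submodule.coe_neg, neg_apply, inner_neg_right, Complex.neg_re] at h2
    linarith
  have hsym := (ContinuousLinearMap.isSelfAdjoint_iff_isSymmetric.1 b.2.2)
  have hb0 : (b : H →L[ℂ] H) = 0 := by
    have : ((b : H →L[ℂ] H) : H →ₗ[ℂ] H) = 0 := by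
      rw [← hsym.inner_map_self_eq_zero]
      intro η
      by_cases h0 : η = 0
      · simp [h0]
      have hn : ‖η‖ ≠ 0 := norm_ne_zero_iff.2 h0
      have h1 := hre (((‖η‖⁻¹ : ℝ) : ℂ) • η) (by rw [norm_smul]; simp [hn])
      rw [map_smul, inner_smul_left, inner_smul_right, Complex.conj_ofReal,
        Complex.re_ofReal_mul, Complex.re_ofReal_mul] at h1
      have h2 : (⟪η, (b : H →L[ℂ] H) η⟫_ℂ).re = 0 := by
        simpa [hn] using h1
      have h3 := hsym.im_inner_apply_self η
      have h4 : ⟪(b : H →L[ℂ] H) η, η⟫_ℂ = ⟪η, (b : H →L[ℂ] H) η⟫_ℂ := hsym η η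
      change ⟪(b : H →L[ℂ] H) η, η⟫_ℂ = 0
      refine Complex.ext ?_ h3
      rw [h4, h2]; rfl
    ext v
    exact congrArg (fun A : H →ₗ[ℂ] H => A v) this
  have : b = 0 := Subtype.ext hb0
  exact sub_eq_zero.1 this

theorem wsl_vector_state {ξ : H} (h : ‖ξ‖ = 1) :
    IsNormalState (fun x : H →L[ℂ] H => ⟪ξ, x ξ⟫_ℂ) := by
  refine ⟨fun n => if n = 0 then ξ else 0, ?_, fun x => ?_⟩
  · rw [tsum_eq_single 0 (by intro n hn; simp [hn])]
    simp [h]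
  · rw [tsum_eq_single 0 (by intro n hn; simp [hn])]
    simp

theorem wsl_deriv_zero (M : VonNeumannAlgebra H) (D : ↥M → ↥M) (hD : IsDerivationOn M D)
    (x : ↥M) (hx : IsSelfAdjoint (x : H →L[ℂ] H)) (ξ : H) (h : (x : H →L[ℂ] H) ξ = 0) :
    ⟪ξ, (D x : H →L[ℂ] H) ξ⟫_ℂ = 0 := by
  let fr : ℝ → ℝ := fun t => √|t|
  let fu : ℝ → ℝ := fun t => √t - √(-t)
  have hfr : Continuous fr := by fun_prop
  have hfu : Continuous fu := by fun_prop
  have hmul : ∀ t, fu t * fr t = t := by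
    intro t
    rcases le_total 0 t with ht | ht
    · simp [fu, fr, abs_of_nonneg ht, Real.sqrt_eq_zero_of_nonpos (neg_nonpos.2 ht),
        Real.mul_self_sqrt ht]
    · simp [fu, fr, abs_of_nonpos ht, Real.sqrt_eq_zero_of_nonpos ht,
        Real.mul_self_sqrt (neg_nonneg.2 ht)]
  have hrr : ∀ t, fr t * fr t = |t| := fun t => Real.mul_self_sqrt (abs_nonneg t)
  have huu : ∀ t, fu t * fu t = |t| := by
    intro t
    rcases le_total 0 t with ht | ht
    · simp [fu, abs_of_nonneg ht, Real.sqrt_eq_zero_of_nonpos (neg_nonpos.2 ht),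
        Real.mul_self_sqrt ht]
    · simp [fu, abs_of_nonpos ht, Real.sqrt_eq_zero_of_nonpos ht,
        Real.mul_self_sqrt (neg_nonneg.2 ht)]
  let A : H →L[ℂ] H := x
  have hA : IsSelfAdjoint A := hx
  have hAid : cfc (fun t : ℝ => t) A = A := cfc_id' ℝ A
  have m1 : cfc fu A * cfc fr A = A := by
    rw [← cfc_mul fu fr A hfu.continuousOn hfr.continuousOn]
    simp only [hmul]
    exact hAid
  have m2 : cfc fr A * cfc fr A = cfc (fun t : ℝ => |t|) A := by
    rw [← cfc_mul fr fr A hfr.continuousOn hfr.continuousOn]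
    simp only [hrr]
  have m3 : cfc fu A * cfc fu A = cfc (fun t : ℝ => |t|) A := by
    rw [← cfc_mul fu fu A hfu.continuousOn hfu.continuousOn]
    simp only [huu]
  have m4 : cfc (fun t : ℝ => |t|) A * cfc (fun t : ℝ => |t|) A = A * A := by
    rw [← cfc_mul (fun t : ℝ => |t|) (fun t : ℝ => |t|) A (by fun_prop) (by fun_prop)]
    simp only [abs_mul_abs_self]
    rw [cfc_mul (fun t : ℝ => t) (fun t : ℝ => t) A (by fun_prop) (by fun_prop), hAid]
  have ev : ∀ {P Q R : H →L[ℂ] H}, P * Q = R → P (Q ξ) = R ξ := fun h => by rw [← h]; rfl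
  have hAξ : A ξ = 0 := h
  have z1 : cfc (fun t : ℝ => |t|) A ξ = 0 := by
    refine wsl_sq_apply (cfc_predicate _ A) ?_
    rw [ev m4]
    change A (A ξ) = 0
    rw [hAξ, map_zero]
  have z2 : cfc fr A ξ = 0 := wsl_sq_apply (cfc_predicate _ A) (by rw [ev m2, z1])
  have z3 : cfc fu A ξ = 0 := wsl_sq_apply (cfc_predicate _ A) (by rw [ev m3, z1])
  let r : ↥M := ⟨cfc fr A, wsl_cfc_mem M x.2 _⟩
  let w : ↥M := ⟨cfc fu A, wsl_cfc_mem M x.2 _⟩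
  have hx' : x = w * r := Subtype.ext m1.symm
  have e : (D x : H →L[ℂ] H) ξ = (D w : H →L[ℂ] H) (cfc fr A ξ) +
      cfc fu A ((D r : H →L[ℂ] H) ξ) := by
    rw [hx', hD.2]; rfl
  rw [e, z2, map_zero, zero_add]
  have hw : IsSelfAdjoint (cfc fu A) := cfc_predicate _ A
  have := ContinuousLinearMap.adjoint_inner_left (cfc fu A) ((D r : H →L[ℂ] H) ξ) ξ
  rw [hw.adjoint_eq, z3, inner_zero_left] at this
  exact this.symm

theorem wsl_T_zero (M : VonNeumannAlgebra H) (T : ↥M → ↥M)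
    (hT : IsWeakStarLocalDerivation M T) (x : ↥M) (hx : IsSelfAdjoint (x : H →L[ℂ] H)) (ξ : H)
    (c : ℝ) (h : (x : H →L[ℂ] H) ξ = (c : ℂ) • ξ) : ⟪ξ, (T x : H →L[ℂ] H) ξ⟫_ℂ = 0 := by
  suffices hunit : ∀ ξ : H, ‖ξ‖ = 1 → (x : H →L[ℂ] H) ξ = (c : ℂ) • ξ →
      ⟪ξ, (T x : H →L[ℂ] H) ξ⟫_ℂ = 0 by
    by_cases h0 : ξ = 0
    · simp [h0]
    have hn : ‖ξ‖ ≠ 0 := norm_ne_zero_iff.2 h0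
    have h1 := hunit (((‖ξ‖⁻¹ : ℝ) : ℂ) • ξ) (by rw [norm_smul]; simp [hn])
      (by rw [map_smul, h, smul_comm])
    rw [map_smul, inner_smul_left, inner_smul_right] at h1
    simpa [hn] using h1
  intro ξ hξ h
  obtain ⟨D, hD, hDe⟩ := hT.2 x _ (wsl_vector_state hξ)
  refine hDe.trans ?_
  have d1 : D 1 = 0 := by
    have := hD.2 1 1
    simpa using this
  let y : ↥M := x - (c : ℂ) • 1
  have hDy : D y = D x := by
    have : D y = D x - (c : ℂ) • D 1 := by
      rw [hD.1.map_sub, hD.1.map_smul]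
    rw [this, d1, smul_zero, sub_zero]
  have hy : (y : H →L[ℂ] H) = (x : H →L[ℂ] H) - (c : ℂ) • 1 := rfl
  change ⟪ξ, (D x : H →L[ℂ] H) ξ⟫_ℂ = 0
  rw [← hDy]
  refine wsl_deriv_zero M D hD y ?_ ξ ?_
  · rw [hy]
    refine hx.sub (IsSelfAdjoint.smul ?_ (IsSelfAdjoint.one _))
    exact Complex.conj_ofReal c
  · rw [hy]
    simp [h]

/-- The restriction of `T` to the self-adjoint part. -/
noncomputable def wslL (M : VonNeumannAlgebra H) (T : ↥M → ↥M) (hT : IsLinearMap ℂ T) :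
    wslSA M →ₗ[ℝ] (H →L[ℂ] H) where
  toFun x := (T ⟨x, x.2.1⟩ : H →L[ℂ] H)
  map_add' x y := by
    have : (⟨((x + y : wslSA M) : H →L[ℂ] H), (x + y).2.1⟩ : ↥M) = ⟨x, x.2.1⟩ + ⟨y, y.2.1⟩ := rfl
    rw [this, hT.map_add]; rfl
  map_smul' c x := by
    have : (⟨((c • x : wslSA M) : H →L[ℂ] H), (c • x).2.1⟩ : ↥M) = (c : ℂ) • ⟨x, x.2.1⟩ :=
      Subtype.ext (by
        change c • (x : H →L[ℂ] H) = (c : ℂ) • (x : H →L[ℂ] H)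
        simp)
    rw [this, hT.map_smul]
    change (c : ℂ) • (T ⟨x, x.2.1⟩ : H →L[ℂ] H) = c • (T ⟨x, x.2.1⟩ : H →L[ℂ] H)
    simp

theorem wsl_herm_mem (M : VonNeumannAlgebra H) (w : ℂ) {a : H →L[ℂ] H} (ha : a ∈ M) :
    w • a + star (w • a) ∈ wslSA M :=
  ⟨add_mem (SMulMemClass.smul_mem w ha) (star_mem (SMulMemClass.smul_mem w ha)),
    IsSelfAdjoint.add_star_self _⟩

noncomputable def wslS (M : VonNeumannAlgebra H) (T : ↥M → ↥M) (hT : IsLinearMap ℂ T) (w : ℂ) :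
    wslSA M →ₗ[ℝ] wslSA M where
  toFun x := ⟨w • wslL M T hT x + star (w • wslL M T hT x), wsl_herm_mem M w (T ⟨x, x.2.1⟩).2⟩
  map_add' x y := Subtype.ext (by
    simp only [map_add, smul_add, star_add, Submodule.coe_add]; abel)
  map_smul' c x := Subtype.ext (by
    simp only [map_smul, RingHom.id_apply, Submodule.coe_smul, smul_add]
    rw [smul_comm w c, star_smul c]
    simp)

theorem wslS_continuous (M : VonNeumannAlgebra H) (T : ↥M → ↥M)
    (hT : IsWeakStarLocalDerivation M T) (w : ℂ) : Continuous (wslS M T hT.1 w) := by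
  refine wsl_continuous_S M _ fun x ξ c h => ?_
  have h0 : ⟪ξ, wslL M T hT.1 x ξ⟫_ℂ = 0 := wsl_T_zero M T hT ⟨x, x.2.1⟩ x.2.2 ξ c h
  have h1 : ⟪ξ, (w • wslL M T hT.1 x) ξ⟫_ℂ = 0 := by
    rw [smul_apply, inner_smul_right, h0, mul_zero]
  change ⟪ξ, (w • wslL M T hT.1 x + star (w • wslL M T hT.1 x)) ξ⟫_ℂ = 0
  rw [add_apply, inner_add_right, h1, zero_add, ContinuousLinearMap.star_eq_adjoint,
    ContinuousLinearMap.adjoint_inner_right, ← inner_conj_symm, h1, map_zero]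

theorem wsl_decomp (a : H →L[ℂ] H) : a = (1/2 : ℂ) • (((1:ℂ) • a + star ((1:ℂ) • a)) +
    Complex.I • ((-Complex.I) • a + star ((-Complex.I) • a))) := by
  have h : star ((-Complex.I) • a) = Complex.I • star a := by
    rw [star_smul]; simp
  rw [h, smul_add Complex.I, smul_smul, smul_smul]
  simp only [one_smul, mul_neg, Complex.I_mul_I, neg_neg, neg_smul]
  have : a + star a + (a + -star a) = (2:ℂ) • a := by rw [two_smul]; abel
  rw [this, smul_smul]
  norm_num

theorem wslL_continuous (M : VonNeumannAlgebra H) (T : ↥M → ↥M)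
    (hT : IsWeakStarLocalDerivation M T) : Continuous (wslL M T hT.1) := by
  have h : ∀ x, wslL M T hT.1 x = (1/2 : ℂ) • ((wslS M T hT.1 1 x : H →L[ℂ] H) +
      Complex.I • (wslS M T hT.1 (-Complex.I) x : H →L[ℂ] H)) := fun x => wsl_decomp _
  have c1 := continuous_subtype_val.comp (wslS_continuous M T hT 1)
  have c2 := continuous_subtype_val.comp (wslS_continuous M T hT (-Complex.I))
  exact ((c1.add (c2.const_smul Complex.I)).const_smul (1/2 : ℂ)).congr fun x => (h x).symm

/-- Every weak*-local derivation on a von Neumann algebra is continuous. -/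
theorem weakStarLocalDerivation_continuous (M : VonNeumannAlgebra H) (T : ↥M → ↥M)
    (hT : IsWeakStarLocalDerivation M T) : Continuous T := by
  let P : ℂ → ↥M → wslSA M := fun w a =>
    ⟨w • (a : H →L[ℂ] H) + star (w • (a : H →L[ℂ] H)), wsl_herm_mem M w a.2⟩
  have hP : ∀ w, Continuous (P w) := fun w => by
    refine Continuous.subtype_mk ?_ _
    have h1 : Continuous fun a : ↥M => w • (a : H →L[ℂ] H) :=
      continuous_subtype_val.const_smul w
    exact h1.add h1.star
  have hL := wslL_continuous M T hT
  have h : ∀ a : ↥M, (T a : H →L[ℂ] H) = (1/2 : ℂ) • (wslL M T hT.1 (P 1 a) +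
      Complex.I • wslL M T hT.1 (P (-Complex.I) a)) := by
    intro a
    have e : a = (1/2 : ℂ) • ((⟨P 1 a, (P 1 a).2.1⟩ : ↥M) +
        Complex.I • (⟨P (-Complex.I) a, (P (-Complex.I) a).2.1⟩ : ↥M)) :=
      Subtype.ext (wsl_decomp _)
    conv_lhs => rw [e, hT.1.map_smul, hT.1.map_add, hT.1.map_smul]
    rfl
  refine continuous_induced_rng.2 ?_
  exact (((hL.comp (hP 1)).add ((hL.comp (hP (-Complex.I))).const_smul Complex.I)).const_smul
    (1/2 : ℂ)).congr fun a => (h a).symm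
end
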